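/- Let n ≥ 2 and let Ω ⊂ ℝⁿ be a bounded set of finite perimeter such that H^{n−1}(∂Ω ∩ Ω¹) = 0. Then there exists a sequence of bounded open sets E_k with smooth boundary such that E_k ⋐ Ω for every k, E_k → Ω in L¹, and P(E_k) → P(Ω). -/

import Mathlib

open MeasureTheory Metric Filter Set
open scoped ENNReal Topology NNReal

noncomputable section

/-- The divergence of a vector field `φ : ℝⁿ → ℝⁿ`. -/
def vdiv {n : ℕ} (φ : EuclideanSpace ℝ (Fin n) → EuclideanSpace ℝ (Fin n))
    (x : EuclideanSpace ℝ (Fin n)) : ℝ :=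
  ∑ i, fderiv ℝ φ x (EuclideanSpace.single i 1) i

/-- The relative perimeter `P(E; W)` of a set `E` in an open set `W`, defined variationally as
`sup { ∫_E div φ : φ ∈ C¹_c(W; ℝⁿ), ‖φ‖_∞ ≤ 1 }`. -/
def relPerimeter {n : ℕ} (E W : Set (EuclideanSpace ℝ (Fin n))) : ℝ≥0∞ :=
  ⨆ (φ : EuclideanSpace ℝ (Fin n) → EuclideanSpace ℝ (Fin n)) (_ : ContDiff ℝ 1 φ)
    (_ : HasCompactSupport φ) (_ : tsupport φ ⊆ W) (_ : ∀ x, ‖φ x‖ ≤ 1),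
    ENNReal.ofReal (∫ x in E, vdiv φ x)

/-- The perimeter `P(E)` of a set `E ⊆ ℝⁿ`:
`P(E) = sup { ∫_E div φ : φ ∈ C¹_c(ℝⁿ; ℝⁿ), ‖φ‖_∞ ≤ 1 }`. -/
def perimeter {n : ℕ} (E : Set (EuclideanSpace ℝ (Fin n))) : ℝ≥0∞ :=
  relPerimeter E Set.univ

/-- The set of points where `Ω` has Lebesgue density `α`; `densityPts Ω 1` is the
measure-theoretic interior `Ω¹` and `densityPts Ω 0` is the measure-theoretic exterior `Ω⁰`. -/
def densityPts {n : ℕ} (Ω : Set (EuclideanSpace ℝ (Fin n))) (α : ℝ≥0∞) :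
    Set (EuclideanSpace ℝ (Fin n)) :=
  {x | Tendsto (fun r : ℝ => volume (Ω ∩ ball x r) / volume (ball x r)) (𝓝[>] 0) (𝓝 α)}

/-- A smooth set: a bounded open set whose topological boundary is a smooth hypersurface,
expressed via a smooth defining function with nonvanishing differential on the boundary. -/
def IsSmoothSet {n : ℕ} (E : Set (EuclideanSpace ℝ (Fin n))) : Prop :=
  IsOpen E ∧ Bornology.IsBounded E ∧
  ∃ f : EuclideanSpace ℝ (Fin n) → ℝ, ContDiff ℝ (⊤ : ℕ∞) f ∧
    E = {x | f x < 0} ∧ frontier E = {x | f x = 0} ∧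
    ∀ x ∈ frontier E, fderiv ℝ f x ≠ 0

/-- `E ⋐ Ω` : the closure of `E` is compact and contained in `Ω`. -/
def CpctContained {n : ℕ} (E Ω : Set (EuclideanSpace ℝ (Fin n))) : Prop :=
  IsCompact (closure E) ∧ closure E ⊆ Ω

/-- `E_k → Ω` in `L¹`, i.e. `|E_k Δ Ω| → 0`. -/
def TendstoL1 {n : ℕ} (E : ℕ → Set (EuclideanSpace ℝ (Fin n)))
    (Ω : Set (EuclideanSpace ℝ (Fin n))) : Prop :=
  Tendsto (fun k => volume ((E k \ Ω) ∪ (Ω \ E k))) atTop (𝓝 0)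

/-- The volume `ω_n` of the unit ball in ℝⁿ. -/
def unitBallVol (n : ℕ) : ℝ≥0∞ := volume (ball (0 : EuclideanSpace ℝ (Fin n)) 1)

/-! ### Basic facts on divergence -/

section Basics
variable {n : ℕ}

local notation "𝔼" => EuclideanSpace ℝ (Fin n)

/-- The linear functional extracting the trace. -/
def trL (n : ℕ) : (EuclideanSpace ℝ (Fin n) →L[ℝ] EuclideanSpace ℝ (Fin n)) →L[ℝ] ℝ :=
  ∑ i, (EuclideanSpace.proj i : EuclideanSpace ℝ (Fin n) →L[ℝ] ℝ).comp
    (ContinuousLinearMap.apply ℝ (EuclideanSpace ℝ (Fin n)) (EuclideanSpace.single i (1:ℝ)))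

lemma vdiv_eq (φ : 𝔼 → 𝔼) (x : 𝔼) : vdiv φ x = trL n (fderiv ℝ φ x) := by
  simp [vdiv, trL]

lemma vdiv_continuous {φ : 𝔼 → 𝔼} (h : ContDiff ℝ 1 φ) : Continuous (vdiv φ) := by
  have : vdiv φ = fun x => trL n (fderiv ℝ φ x) := funext (vdiv_eq φ)
  rw [this]
  exact (trL n).continuous.comp (h.continuous_fderiv one_ne_zero)

lemma vdiv_support {φ : 𝔼 → 𝔼} : tsupport (vdiv φ) ⊆ tsupport φ := by
  refine closure_minimal ?_ (isClosed_tsupport φ)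
  intro x hx
  by_contra h
  apply hx
  have h2 : fderiv ℝ φ x = 0 := by
    by_contra h3
    exact h (support_fderiv_subset ℝ h3)
  simp [vdiv_eq, h2]

lemma vdiv_hcs {φ : 𝔼 → 𝔼} (h : HasCompactSupport φ) : HasCompactSupport (vdiv φ) :=
  h.of_isClosed_subset (isClosed_tsupport _) vdiv_support

lemma vdiv_integrable {φ : 𝔼 → 𝔼} (h : ContDiff ℝ 1 φ) (hc : HasCompactSupport φ) :
    Integrable (vdiv φ) :=
  (vdiv_continuous h).integrable_of_hasCompactSupport (vdiv_hcs hc)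

lemma vdiv_smul {f : 𝔼 → ℝ} {φ : 𝔼 → 𝔼} {x : 𝔼} (hf : DifferentiableAt ℝ f x)
    (hφ : DifferentiableAt ℝ φ x) :
    vdiv (fun x => f x • φ x) x = f x * vdiv φ x + fderiv ℝ f x (φ x) := by
  unfold vdiv
  have : fderiv ℝ (fun x => f x • φ x) x = _ := fderiv_fun_smul hf hφ
  rw [this]
  simp only [add_apply, smul_apply,
    ContinuousLinearMap.smulRight_apply, PiLp.add_apply, PiLp.smul_apply, smul_eq_mul,
    Finset.sum_add_distrib, Finset.mul_sum]
  congr 1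
  have h2 : φ x = ∑ i, (φ x i) • EuclideanSpace.single i (1:ℝ) := by
    ext j
    simp [Finset.sum_apply, Pi.single_apply]
  conv_rhs => rw [h2, map_sum]
  refine Finset.sum_congr rfl fun i _ => ?_
  simp [mul_comm]

lemma vdiv_add {φ ψ : 𝔼 → 𝔼} {x : 𝔼} (hψ : DifferentiableAt ℝ ψ x)
    (hφ : DifferentiableAt ℝ φ x) :
    vdiv (fun x => φ x + ψ x) x = vdiv φ x + vdiv ψ x := by
  simp only [vdiv_eq]
  rw [fderiv_fun_add hφ hψ, map_add]

lemma vdiv_const_smul {φ : 𝔼 → 𝔼} {x : 𝔼} (c : ℝ)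
    (hφ : DifferentiableAt ℝ φ x) :
    vdiv (fun x => c • φ x) x = c * vdiv φ x := by
  simp only [vdiv_eq]
  rw [fderiv_fun_const_smul hφ, map_smul, smul_eq_mul]

lemma integral_vdiv {φ : 𝔼 → 𝔼} (h : ContDiff ℝ 1 φ) (hc : HasCompactSupport φ) :
    ∫ x, vdiv φ x = 0 := by
  have hcd : HasCompactSupport (fderiv ℝ φ) := hc.fderiv ℝ
  have hcont := h.continuous_fderiv one_ne_zero
  have hintg : ∀ i, Integrable (fun x => fderiv ℝ φ x (EuclideanSpace.single i 1) i) := by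
    intro i
    apply Continuous.integrable_of_hasCompactSupport
    · exact (EuclideanSpace.proj (𝕜 := ℝ) i).continuous.comp (hcont.clm_apply continuous_const)
    · exact hcd.comp_left (g := fun L : 𝔼 →L[ℝ] 𝔼 => L (EuclideanSpace.single i 1) i) (by simp)
  unfold vdiv
  rw [integral_finsetSum _ (fun i _ => hintg i)]
  refine Finset.sum_eq_zero fun i _ => ?_
  let g : 𝔼 → ℝ := fun x => φ x i
  have hg : ContDiff ℝ 1 g := (EuclideanSpace.proj (𝕜 := ℝ) i).contDiff.comp h
  have hgc : HasCompactSupport g := hc.comp_left (g := fun v : 𝔼 => v i) (by simp)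
  have hgd : ∀ x, fderiv ℝ g x (EuclideanSpace.single i 1) = fderiv ℝ φ x (EuclideanSpace.single i 1) i := by
    intro x
    have := (EuclideanSpace.proj (𝕜 := ℝ) i).hasFDerivAt.comp x (h.differentiable one_ne_zero x).hasFDerivAt
    have h3 : HasFDerivAt g ((EuclideanSpace.proj (𝕜 := ℝ) i).comp (fderiv ℝ φ x)) x := this
    rw [h3.fderiv]; rfl
  simp_rw [← hgd]
  have := integral_mul_fderiv_eq_neg_fderiv_mul_of_integrable (μ := (volume : Measure 𝔼))
    (f := fun _ : 𝔼 => (1:ℝ)) (g := g)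
    (v := EuclideanSpace.single i 1) (by simp) (by simpa [hgd] using hintg i)
    (by simpa using hg.continuous.integrable_of_hasCompactSupport hgc) (fun x _ => by fun_prop)
    (fun x _ => hg.differentiable one_ne_zero x)
  simpa using this

lemma ibp {u : 𝔼 → ℝ} {φ : 𝔼 → 𝔼} (hu : ContDiff ℝ 1 u) (h : ContDiff ℝ 1 φ)
    (hc : HasCompactSupport φ) :
    ∫ x, u x * vdiv φ x = - ∫ x, fderiv ℝ u x (φ x) := by
  have h0 : ∫ x, vdiv (fun x => u x • φ x) x = 0 :=
    integral_vdiv (hu.smul h) (hc.smul_left (f := u))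
  have h1 : ∀ x, vdiv (fun x => u x • φ x) x = u x * vdiv φ x + fderiv ℝ u x (φ x) := fun x =>
    vdiv_smul (hu.differentiable one_ne_zero x) (h.differentiable one_ne_zero x)
  simp_rw [h1] at h0
  rw [integral_add] at h0
  · linarith
  · exact (hu.continuous.mul (vdiv_continuous h)).integrable_of_hasCompactSupport
      ((vdiv_hcs hc).mul_left)
  · apply Continuous.integrable_of_hasCompactSupport
    · exact (hu.continuous_fderiv one_ne_zero).clm_apply h.continuous
    · apply hc.mono'
      intro x hx
      apply subset_tsupport
      intro h; apply hx; simp [h]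

/-! ### Relative perimeter -/

/-- Admissible test fields. -/
structure IsTest (W : Set (EuclideanSpace ℝ (Fin n)))
    (φ : EuclideanSpace ℝ (Fin n) → EuclideanSpace ℝ (Fin n)) : Prop where
  cd : ContDiff ℝ 1 φ
  cs : HasCompactSupport φ
  sub : tsupport φ ⊆ W
  le : ∀ x, ‖φ x‖ ≤ 1

lemma IsTest.mono {W W' : Set 𝔼} {φ : 𝔼 → 𝔼} (h : IsTest W φ) (hW : W ⊆ W') : IsTest W' φ :=
  ⟨h.cd, h.cs, h.sub.trans hW, h.le⟩

lemma isTest_zero (W : Set 𝔼) : IsTest W (fun _ => (0 : 𝔼)) := by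
  refine ⟨contDiff_const, HasCompactSupport.zero, ?_, by simp⟩
  have : tsupport (fun _ : 𝔼 => (0:𝔼)) = ∅ := by rw [tsupport_eq_empty_iff]; rfl
  simp [this]

lemma IsTest.le_relP {E W : Set 𝔼} {φ : 𝔼 → 𝔼} (h : IsTest W φ) :
    ENNReal.ofReal (∫ x in E, vdiv φ x) ≤ relPerimeter E W := by
  unfold relPerimeter
  refine le_iSup_of_le φ (le_iSup_of_le h.cd (le_iSup_of_le h.cs (le_iSup_of_le h.sub
    (le_iSup_of_le h.le le_rfl))))

lemma relP_le {E W : Set 𝔼} {c : ℝ≥0∞}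
    (h : ∀ φ, IsTest W φ → ENNReal.ofReal (∫ x in E, vdiv φ x) ≤ c) : relPerimeter E W ≤ c := by
  unfold relPerimeter
  refine iSup_le fun φ => iSup_le fun h1 => iSup_le fun h2 => iSup_le fun h3 => iSup_le fun h4 => ?_
  exact h φ ⟨h1, h2, h3, h4⟩

lemma relP_mono {E W W' : Set 𝔼} (h : W ⊆ W') : relPerimeter E W ≤ relPerimeter E W' :=
  relP_le fun _ hφ => (hφ.mono h).le_relP

lemma relP_ne_top {E : Set 𝔼} (h : perimeter E ≠ ⊤) (W : Set 𝔼) : relPerimeter E W ≠ ⊤ :=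
  ne_top_of_le_ne_top h (relP_mono (subset_univ W))

/-- Real-valued relative perimeter. -/
def rP (E W : Set (EuclideanSpace ℝ (Fin n))) : ℝ := (relPerimeter E W).toReal

lemma rP_nonneg (E W : Set 𝔼) : 0 ≤ rP E W := ENNReal.toReal_nonneg

lemma rP_mono {E W W' : Set 𝔼} (hE : perimeter E ≠ ⊤) (h : W ⊆ W') : rP E W ≤ rP E W' :=
  ENNReal.toReal_mono (relP_ne_top hE _) (relP_mono h)

lemma IsTest.le_rP {E W : Set 𝔼} {φ : 𝔼 → 𝔼} (hE : perimeter E ≠ ⊤) (h : IsTest W φ) :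
    ∫ x in E, vdiv φ x ≤ rP E W :=
  (ENNReal.ofReal_le_iff_le_toReal (relP_ne_top hE _)).1 h.le_relP

lemma le_rP_scaled {E W : Set 𝔼} {φ : 𝔼 → 𝔼} (hE : perimeter E ≠ ⊤) {c : ℝ} (hc : 0 ≤ c)
    (cd : ContDiff ℝ 1 φ) (cs : HasCompactSupport φ) (sub : tsupport φ ⊆ W)
    (le : ∀ x, ‖φ x‖ ≤ c) : ∫ x in E, vdiv φ x ≤ c * rP E W := by
  rcases hc.eq_or_lt with rfl | hc
  · have : φ = fun _ => 0 := funext fun x => by simpa using le x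
    have h2 : ∀ x, vdiv φ x = 0 := fun x => by rw [vdiv_eq, this]; simp
    simp [h2]
  · have ht : IsTest W (fun x => c⁻¹ • φ x) := by
      refine ⟨cd.const_smul _, cs.smul_left (f := fun _ => c⁻¹), ?_, ?_⟩
      · exact (tsupport_smul_subset_right (fun _ => c⁻¹) φ).trans sub
      · intro x
        rw [norm_smul, Real.norm_of_nonneg (by positivity)]
        rw [inv_mul_le_iff₀ hc]; simpa using le x
    have := ht.le_rP hE
    simp_rw [fun x => vdiv_const_smul c⁻¹ (cd.differentiable one_ne_zero x)] at this
    rw [integral_const_mul, inv_mul_le_iff₀ hc] at this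
    exact this

lemma exists_test {E : Set 𝔼} (W : Set 𝔼) {η : ℝ} (hη : 0 < η) :
    ∃ φ, IsTest W φ ∧ rP E W - η < ∫ x in E, vdiv φ x := by
  by_contra! h
  by_cases h0 : rP E W - η < 0
  · have := h _ (isTest_zero W)
    have h2 : ∀ x, vdiv (fun _ : 𝔼 => (0:𝔼)) x = 0 := fun x => by rw [vdiv_eq]; simp
    simp [h2] at this
    linarith
  · push Not at h0
    have : relPerimeter E W ≤ ENNReal.ofReal (rP E W - η) :=
      relP_le fun φ hφ => ENNReal.ofReal_le_ofReal (h φ hφ)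
    have h3 := ENNReal.toReal_mono ENNReal.ofReal_ne_top this
    rw [ENNReal.toReal_ofReal h0] at h3
    have : rP E W ≤ rP E W - η := h3
    linarith

lemma rP_superadd {E W₁ W₂ W : Set 𝔼} (hE : perimeter E ≠ ⊤)
    (hd : Disjoint W₁ W₂) (h₁ : W₁ ⊆ W) (h₂ : W₂ ⊆ W) :
    rP E W₁ + rP E W₂ ≤ rP E W := by
  refine le_of_forall_pos_le_add fun η hη => ?_
  obtain ⟨φ, hφ, hφPr⟩ := exists_test (E := E) W₁ (half_pos hη)
  obtain ⟨ψ, hψ, hψPr⟩ := exists_test (E := E) W₂ (half_pos hη)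
  have ht : IsTest W (fun x => φ x + ψ x) := by
    refine ⟨hφ.cd.add hψ.cd, hφ.cs.add hψ.cs, ?_, ?_⟩
    · refine (tsupport_add φ ψ).trans ?_
      exact union_subset (hφ.sub.trans h₁) (hψ.sub.trans h₂)
    · intro x
      by_cases hx : φ x = 0
      · simpa [hx] using hψ.le x
      · have : ψ x = 0 := by
          by_contra hx2
          exact hd.le_bot ⟨hφ.sub (subset_tsupport _ hx), hψ.sub (subset_tsupport _ hx2)⟩
        simpa [this] using hφ.le x
  have h := ht.le_rP hE
  simp_rw [fun x => vdiv_add (hψ.cd.differentiable one_ne_zero x)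
    (hφ.cd.differentiable one_ne_zero x)] at h
  rw [integral_add (vdiv_integrable hφ.cd hφ.cs).integrableOn
    (vdiv_integrable hψ.cd hψ.cs).integrableOn] at h
  linarith

lemma rP_sum_le {ι : Type*} {E W : Set 𝔼} (hE : perimeter E ≠ ⊤) (s : Finset ι) (B : ι → Set 𝔼)
    (hd : (s : Set ι).PairwiseDisjoint B) (hB : ∀ i ∈ s, B i ⊆ W) :
    ∑ i ∈ s, rP E (B i) ≤ rP E W := by
  classical
  suffices H : ∑ i ∈ s, rP E (B i) ≤ rP E (⋃ i ∈ s, B i) from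
    H.trans (rP_mono hE (iUnion₂_subset hB))
  induction s using Finset.induction_on with
  | empty => simpa using rP_nonneg _ _
  | insert a s ha ih =>
    rw [Finset.sum_insert ha]
    have h1 := ih (hd.subset (by simp)) (fun i hi => hB i (Finset.mem_insert_of_mem hi))
    have h2 : Disjoint (B a) (⋃ i ∈ s, B i) := by
      rw [disjoint_iUnion₂_right]
      intro i hi
      exact hd (by simp) (by simp [hi]) (fun h => ha (h ▸ hi))
    refine (add_le_add_right h1 _).trans (rP_superadd hE h2 ?_ ?_)
    · intro x hx; simp [hx]
    · intro x hx; simp at hx ⊢; exact Or.inr hx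

end Basics

/-! ### Mollification -/

section Mollify
open scoped Convolution
variable {n : ℕ}

local notation "𝔼" => EuclideanSpace ℝ (Fin n)

/-- positive version of a scale parameter -/
def ep (ε : ℝ) : ℝ := if 0 < ε then ε else 1

lemma ep_pos (ε : ℝ) : 0 < ep ε := by unfold ep; split_ifs <;> linarith

lemma ep_eq {ε : ℝ} (h : 0 < ε) : ep ε = ε := if_pos h

/-- the bump function at scale `ε` -/
def bmp (n : ℕ) (ε : ℝ) : ContDiffBump (0 : EuclideanSpace ℝ (Fin n)) :=
  ⟨ep ε / 2, ep ε, half_pos (ep_pos ε), half_lt_self (ep_pos ε)⟩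

/-- the mollifier at scale `ε` -/
def mol (n : ℕ) (ε : ℝ) : EuclideanSpace ℝ (Fin n) → ℝ := (bmp n ε).normed volume

lemma mol_nonneg (ε : ℝ) (x : 𝔼) : 0 ≤ mol n ε x := ContDiffBump.nonneg_normed _ _

lemma mol_neg (ε : ℝ) (x : 𝔼) : mol n ε (-x) = mol n ε x := ContDiffBump.normed_neg _ _

lemma mol_sub (ε : ℝ) (x y : 𝔼) : mol n ε (x - y) = mol n ε (y - x) := by
  rw [← mol_neg, neg_sub]

lemma mol_cont (ε : ℝ) : Continuous (mol n ε) := ContDiffBump.continuous_normed _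

lemma mol_contDiff (ε : ℝ) {m : ℕ∞} : ContDiff ℝ m (mol n ε) := ContDiffBump.contDiff_normed _

lemma mol_hcs (ε : ℝ) : HasCompactSupport (mol n ε) := ContDiffBump.hasCompactSupport_normed _

lemma mol_integrable (ε : ℝ) : Integrable (mol n ε) := ContDiffBump.integrable_normed _

lemma mol_integral (ε : ℝ) : ∫ x, mol n ε x = 1 := ContDiffBump.integral_normed _

lemma mol_zero {ε : ℝ} (hε : 0 < ε) {x : 𝔼} (hx : ε ≤ ‖x‖) : mol n ε x = 0 := by
  have h := (bmp n ε).support_normed_eq (μ := volume)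
  by_contra h2
  have : x ∈ Function.support ((bmp n ε).normed volume) := h2
  rw [h] at this
  simp [bmp, ep_eq hε] at this
  linarith

lemma mol_le {ε : ℝ} (hε : 0 < ε) (x : 𝔼) :
    mol n ε x ≤ 1 / volume.real (closedBall (0 : 𝔼) (ε / 2)) := by
  have := (bmp n ε).normed_le_div_measure_closedBall_rIn (μ := volume) x
  simpa [bmp, ep_eq hε, mol] using this

lemma mol_ge {ε : ℝ} (hε : 0 < ε) {x : 𝔼} (hx : ‖x‖ ≤ ε / 2) :
    1 / volume.real (closedBall (0 : 𝔼) ε) ≤ mol n ε x := by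
  have h1 := (bmp n ε).integral_le_measure_closedBall (μ := volume)
  have h2 := (bmp n ε).integral_pos (μ := volume)
  have h3 : (bmp n ε) x = 1 := (bmp n ε).one_of_mem_closedBall (by simpa [bmp, ep_eq hε] using hx)
  unfold mol
  rw [ContDiffBump.normed_def, h3]
  have h4 : (bmp n ε).rOut = ε := by simp [bmp, ep_eq hε]
  rw [h4] at h1
  exact one_div_le_one_div_of_le h2 h1

/-- smoothing operator -/
def Sm {F : Type*} [NormedAddCommGroup F] [NormedSpace ℝ F] (ε : ℝ)
    (f : EuclideanSpace ℝ (Fin n) → F) : EuclideanSpace ℝ (Fin n) → F :=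
  mol n ε ⋆[ContinuousLinearMap.lsmul ℝ ℝ, volume] f

section gen
variable {F : Type*} [NormedAddCommGroup F] [NormedSpace ℝ F]

lemma Sm_apply (ε : ℝ) (f : 𝔼 → F) (x : 𝔼) : Sm ε f x = ∫ t, mol n ε t • f (x - t) := by
  simp [Sm, convolution_def]

lemma Sm_apply' (ε : ℝ) (f : 𝔼 → F) (x : 𝔼) : Sm ε f x = ∫ t, mol n ε (x - t) • f t := by
  simp [Sm, convolution_eq_swap]

lemma Sm_contDiff (ε : ℝ) {f : 𝔼 → F} (hf : LocallyIntegrable f) {m : ℕ∞} :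
    ContDiff ℝ m (Sm ε f) :=
  (mol_hcs ε).contDiff_convolution_left _ (mol_contDiff ε) hf

lemma Sm_norm_le (ε : ℝ) {f : 𝔼 → F} {c : ℝ} (hf : ∀ x, ‖f x‖ ≤ c) (x : 𝔼) :
    ‖Sm ε f x‖ ≤ c := by
  rw [Sm_apply]
  calc ‖∫ t, mol n ε t • f (x - t)‖ ≤ ∫ t, mol n ε t * c := by
        apply norm_integral_le_of_norm_le ((mol_integrable ε).mul_const c)
        refine Eventually.of_forall fun t => ?_
        rw [norm_smul, Real.norm_of_nonneg (mol_nonneg ε t)]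
        exact mul_le_mul_of_nonneg_left (hf _) (mol_nonneg ε t)
    _ = c := by rw [integral_mul_const, mol_integral, one_mul]

lemma Sm_zero {ε : ℝ} (hε : 0 < ε) {f : 𝔼 → F} {x : 𝔼} (h : ∀ t, dist t x < ε → f t = 0) :
    Sm ε f x = 0 := by
  rw [Sm_apply']
  rw [integral_eq_zero_of_ae]
  refine Eventually.of_forall fun t => ?_
  by_cases ht : dist t x < ε
  · simp [h t ht]
  · have : mol n ε (x - t) = 0 := mol_zero hε (by rw [← dist_eq_norm, dist_comm]; linarith)
    simp [this]

lemma Sm_hcs {ε : ℝ} {f : 𝔼 → F} (hf : HasCompactSupport f) : HasCompactSupport (Sm ε f) :=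
  HasCompactSupport.convolution _ (mol_hcs ε) hf

end gen

lemma vdiv_Sm (ε : ℝ) {φ : 𝔼 → 𝔼} (h : ContDiff ℝ 1 φ) (hc : HasCompactSupport φ) (x : 𝔼) :
    vdiv (Sm ε φ) x = Sm ε (vdiv φ) x := by
  have hd := hc.hasFDerivAt_convolution_right (ContinuousLinearMap.lsmul ℝ ℝ)
    (mol_integrable (n := n) ε).locallyIntegrable h x
  have hd' : HasFDerivAt (Sm ε φ) _ x := hd
  rw [vdiv_eq, hd'.fderiv, convolution_def, Sm_apply]
  rw [← ContinuousLinearMap.integral_comp_comm]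
  · congr 1
    ext t
    rw [vdiv_eq]
    have : ((ContinuousLinearMap.lsmul ℝ ℝ).precompR 𝔼 (mol n ε t)) (fderiv ℝ φ (x - t))
      = mol n ε t • fderiv ℝ φ (x - t) := by
      ext v; simp [ContinuousLinearMap.precompR_apply]
    rw [this, map_smul]
  · have := (HasCompactSupport.convolutionExists_right (μ := volume)
      ((ContinuousLinearMap.lsmul ℝ ℝ).precompR 𝔼) (hc.fderiv ℝ)
      (mol_integrable (n := n) ε).locallyIntegrable (h.continuous_fderiv one_ne_zero)) x
    exact this

lemma Sm_selfadj {ε : ℝ} {f g : 𝔼 → ℝ} (hf : Integrable f) (hg : Integrable g) :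
    ∫ x, Sm ε f x * g x = ∫ x, f x * Sm ε g x := by
  have hintg : Integrable (Function.uncurry fun x t : 𝔼 => mol n ε (x - t) * (g x * f t))
      (volume.prod volume) := by
    have h1 : Integrable (fun z : 𝔼 × 𝔼 => g z.1 * f z.2) (volume.prod volume) := hg.mul_prod hf
    obtain ⟨C, hC⟩ := (mol_hcs (n := n) ε).exists_bound_of_continuous (mol_cont ε)
    refine h1.bdd_mul (c := C) ?_ ?_
    · exact ((mol_cont ε).comp (continuous_fst.sub continuous_snd)).aestronglyMeasurable
    · exact Eventually.of_forall fun z => hC _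
  calc ∫ x, Sm ε f x * g x = ∫ x, ∫ t, mol n ε (x - t) * (g x * f t) := by
        congr 1; ext x
        rw [Sm_apply', ← integral_mul_const]
        congr 1; ext t
        simp only [smul_eq_mul]; ring
    _ = ∫ t, ∫ x, mol n ε (x - t) * (g x * f t) := integral_integral_swap hintg
    _ = ∫ x, f x * Sm ε g x := by
        congr 1; ext t
        rw [Sm_apply', ← integral_const_mul]
        congr 1; ext x
        rw [mol_sub]
        simp only [smul_eq_mul]; ring

/-! ### The mollified indicator -/

/-- indicator of `Ω` as a real function -/
def ind (Ω : Set (EuclideanSpace ℝ (Fin n))) : EuclideanSpace ℝ (Fin n) → ℝ := Ω.indicator 1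

lemma ind_integral (Ω : Set 𝔼) (hm : MeasurableSet Ω) (f : 𝔼 → ℝ) :
    ∫ x, ind Ω x * f x = ∫ x in Ω, f x := by
  rw [← integral_indicator hm]
  congr 1; ext x
  by_cases hx : x ∈ Ω <;> simp [ind, hx]

lemma ind_nonneg (Ω : Set 𝔼) (x : 𝔼) : 0 ≤ ind Ω x := by
  by_cases hx : x ∈ Ω <;> simp [ind, hx]

lemma ind_le (Ω : Set 𝔼) (x : 𝔼) : ind Ω x ≤ 1 := by
  by_cases hx : x ∈ Ω <;> simp [ind, hx]

lemma ind_integrable {Ω : Set 𝔼} (hm : MeasurableSet Ω) (hb : Bornology.IsBounded Ω) :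
    Integrable (ind Ω) := by
  unfold ind
  have := (integrable_indicator_iff (μ := (volume : Measure 𝔼)) (f := (1 : 𝔼 → ℝ)) hm).2
    (integrableOn_const (hs := hb.measure_lt_top.ne))
  exact this

/-- mollified indicator -/
def um (Ω : Set (EuclideanSpace ℝ (Fin n))) (ε : ℝ) : EuclideanSpace ℝ (Fin n) → ℝ :=
  Sm ε (ind Ω)

lemma um_contDiff {Ω : Set 𝔼} (hm : MeasurableSet Ω) (hb : Bornology.IsBounded Ω) (ε : ℝ)
    {m : ℕ∞} : ContDiff ℝ m (um Ω ε) := Sm_contDiff ε (ind_integrable hm hb).locallyIntegrable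

lemma um_nonneg (Ω : Set 𝔼) (ε : ℝ) (x : 𝔼) : 0 ≤ um Ω ε x := by
  unfold um; rw [Sm_apply]
  exact integral_nonneg fun t => mul_nonneg (mol_nonneg _ _) (ind_nonneg _ _)

lemma um_le (Ω : Set 𝔼) (ε : ℝ) (x : 𝔼) : um Ω ε x ≤ 1 :=
  (le_abs_self _).trans (Sm_norm_le ε (f := ind Ω) (c := 1) (fun y => by
    rw [Real.norm_of_nonneg (ind_nonneg Ω y)]; exact ind_le Ω y) x)

lemma ind_hcs {Ω : Set 𝔼} (hb : Bornology.IsBounded Ω) : HasCompactSupport (ind Ω) := by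
  apply HasCompactSupport.intro (hb.isCompact_closure)
  intro x hx
  have : x ∉ Ω := fun h => hx (subset_closure h)
  simp [ind, this]

lemma um_hcs {Ω : Set 𝔼} (hb : Bornology.IsBounded Ω) (ε : ℝ) : HasCompactSupport (um Ω ε) :=
  Sm_hcs (ind_hcs hb)

lemma um_ae {Ω : Set 𝔼} (hm : MeasurableSet Ω) (hb : Bornology.IsBounded Ω) :
    ∀ᵐ x, Tendsto (fun ε => um Ω ε x) (𝓝[>] 0) (𝓝 (ind Ω x)) := by
  refine ContDiffBump.ae_convolution_tendsto_right_of_locallyIntegrable (μ := volume)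
    (φ := bmp n) (K := 2) ?_ ?_ (ind_integrable hm hb).locallyIntegrable
  · have : Tendsto (fun ε : ℝ => ε) (𝓝[>] 0) (𝓝 0) := tendsto_nhdsWithin_of_tendsto_nhds tendsto_id
    refine this.congr' ?_
    filter_upwards [self_mem_nhdsWithin] with ε hε
    simp [bmp, ep_eq hε]
  · refine Eventually.of_forall fun ε => ?_
    simp [bmp]; linarith

lemma um_zero_far {Ω : Set 𝔼} {R ε : ℝ} (hε : 0 < ε) (hε1 : ε ≤ 1) (hR : Ω ⊆ closedBall 0 R)
    {x : 𝔼} (hx : x ∉ closedBall (0 : 𝔼) (R + 1)) : um Ω ε x = 0 := by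
  refine Sm_zero hε fun t ht => ?_
  have : t ∉ Ω := by
    intro h
    have h2 := hR h
    simp only [mem_closedBall] at h2 hx
    have := dist_triangle x t 0
    rw [dist_comm x t] at this
    linarith
  simp [ind, this]

lemma um_comp_tendsto {Ω : Set 𝔼} (hm : MeasurableSet Ω) (hb : Bornology.IsBounded Ω)
    {g : ℝ → ℝ} (hg : Continuous g) {ψ : 𝔼 → ℝ} (hψ : Integrable ψ) :
    Tendsto (fun ε => ∫ x, g (um Ω ε x) * ψ x) (𝓝[>] 0) (𝓝 (∫ x, g (ind Ω x) * ψ x)) := by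
  obtain ⟨C, hC⟩ := (isCompact_Icc (a := (0:ℝ)) (b := 1)).exists_bound_of_continuousOn hg.continuousOn
  refine tendsto_integral_filter_of_dominated_convergence (fun x => C * ‖ψ x‖) ?_ ?_ ?_ ?_
  · refine Eventually.of_forall fun ε => ?_
    exact (hg.comp (um_contDiff hm hb ε (m := 0)).continuous).aestronglyMeasurable.mul
      hψ.aestronglyMeasurable
  · refine Eventually.of_forall fun ε => Eventually.of_forall fun x => ?_
    rw [norm_mul]
    exact mul_le_mul_of_nonneg_right (hC _ ⟨um_nonneg _ _ _, um_le _ _ _⟩) (norm_nonneg _)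
  · exact hψ.norm.const_mul C
  · filter_upwards [um_ae hm hb] with x hx
    exact ((hg.tendsto _).comp hx).mul_const _

lemma um_L1 {Ω : Set 𝔼} (hm : MeasurableSet Ω) (hb : Bornology.IsBounded Ω)
    {g : ℝ → ℝ} (hg : Continuous g) :
    Tendsto (fun ε => ∫ x, |g (um Ω ε x) - g (ind Ω x)|) (𝓝[>] 0) (𝓝 0) := by
  obtain ⟨C, hC⟩ := (isCompact_Icc (a := (0:ℝ)) (b := 1)).exists_bound_of_continuousOn hg.continuousOn
  obtain ⟨R, hR⟩ := hb.subset_closedBall (0 : 𝔼)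
  have h0 : (0 : ℝ) = ∫ x : 𝔼, (0 : ℝ) := by simp
  have hε1 : ∀ᶠ ε : ℝ in 𝓝[>] 0, ε ≤ 1 := by
    apply eventually_nhdsWithin_of_eventually_nhds
    exact (eventually_lt_nhds one_pos).mono fun _ h => h.le
  conv => enter [3]; rw [h0]
  refine tendsto_integral_filter_of_dominated_convergence
    ((closedBall (0:𝔼) (R+1)).indicator fun x => 2 * C) ?_ ?_ ?_ ?_
  · refine Eventually.of_forall fun ε => ?_
    have a1 : AEStronglyMeasurable (fun x => g (um Ω ε x)) volume :=
      (hg.comp (um_contDiff hm hb ε (m := 0)).continuous).aestronglyMeasurable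
    have a2 : AEStronglyMeasurable (fun x => g (ind Ω x)) volume :=
      hg.comp_aestronglyMeasurable (ind_integrable hm hb).aestronglyMeasurable
    exact (a1.sub a2).norm
  · filter_upwards [hε1, self_mem_nhdsWithin] with ε h1 h2
    refine Eventually.of_forall fun x => ?_
    by_cases hx : x ∈ closedBall (0:𝔼) (R+1)
    · rw [indicator_of_mem hx, Real.norm_eq_abs, abs_abs]
      have a1 := hC _ ⟨um_nonneg Ω ε x, um_le Ω ε x⟩
      have a2 := hC _ ⟨ind_nonneg Ω x, ind_le Ω x⟩
      have := abs_sub (g (um Ω ε x)) (g (ind Ω x))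
      simp only [Real.norm_eq_abs] at a1 a2
      linarith
    · rw [indicator_of_notMem hx, um_zero_far h2 h1 hR hx]
      have : x ∉ Ω := fun h => hx (closedBall_subset_closedBall (by linarith) (hR h))
      simp [ind, this]
  · rw [integrable_indicator_iff measurableSet_closedBall]
    exact integrableOn_const (hs := measure_closedBall_lt_top.ne)
  · filter_upwards [um_ae hm hb] with x hx
    have := (((hg.tendsto _).comp hx).sub_const (g (ind Ω x))).abs
    simpa using this

end Mollify

/-! ### Perimeter estimates for the mollified indicator -/

section Key
variable {n : ℕ}

local notation "𝔼" => EuclideanSpace ℝ (Fin n)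

lemma integral_norm_fderiv_le {u : 𝔼 → ℝ} (hu : ContDiff ℝ (⊤ : ℕ∞) u) (hc : HasCompactSupport u)
    {c : ℝ} (h : ∀ φ, IsTest univ φ → ∫ x, u x * vdiv φ x ≤ c) :
    ∫ x, ‖fderiv ℝ u x‖ ≤ c := by
  let G : 𝔼 → 𝔼 := fun x => (InnerProductSpace.toDual ℝ 𝔼).symm (fderiv ℝ u x)
  have hGn : ∀ x, ‖G x‖ = ‖fderiv ℝ u x‖ := fun x => LinearIsometryEquiv.norm_map _ _
  have hGc : ContDiff ℝ 1 G := by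
    have h1 : ContDiff ℝ 1 (fderiv ℝ u) := hu.fderiv_right (m := 1) (by norm_cast)
    exact ((InnerProductSpace.toDual ℝ 𝔼).symm.toContinuousLinearEquiv.contDiff).comp h1
  have hGs : HasCompactSupport G := (hc.fderiv ℝ).comp_left (map_zero _)
  have hGi : ∀ x v, fderiv ℝ u x v = inner ℝ (G x) v := by
    intro x v
    simp [G]
  have hintg : Integrable (fun x => ‖fderiv ℝ u x‖) :=
    ((hu.continuous_fderiv (by simp)).norm).integrable_of_hasCompactSupport (hc.fderiv ℝ).norm
  set K := volume.real (tsupport u) with hK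
  have key : ∀ τ > 0, ∫ x, ‖fderiv ℝ u x‖ ≤ c + τ * K := by
    intro τ hτ
    let q : 𝔼 → ℝ := fun x => (Real.sqrt (‖G x‖ ^ 2 + τ ^ 2))⁻¹
    have hpos : ∀ x, 0 < ‖G x‖ ^ 2 + τ ^ 2 := fun x => by positivity
    have hq : ContDiff ℝ 1 q := by
      refine ContDiff.inv (ContDiff.sqrt ?_ (fun x => (hpos x).ne')) ?_
      · exact (hGc.norm_sq ℝ).add contDiff_const
      · intro x; exact (Real.sqrt_pos.2 (hpos x)).ne'
    have hsq : ∀ x, ‖G x‖ ≤ Real.sqrt (‖G x‖ ^ 2 + τ ^ 2) := fun x =>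
      Real.le_sqrt_of_sq_le (by nlinarith)
    have hsq2 : ∀ x, Real.sqrt (‖G x‖ ^ 2 + τ ^ 2) ≤ ‖G x‖ + τ := fun x =>
      Real.sqrt_le_iff.2 ⟨by positivity, by nlinarith [norm_nonneg (G x)]⟩
    let φ : 𝔼 → 𝔼 := fun x => (-q x) • G x
    have hφcd : ContDiff ℝ 1 φ := hq.neg.smul hGc
    have hφcs : HasCompactSupport φ := hGs.smul_left (f := fun x => -q x)
    have ht : IsTest univ φ := by
      refine ⟨hφcd, hφcs, subset_univ _, fun x => ?_⟩
      simp only [φ, q]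
      rw [norm_smul, norm_neg, Real.norm_of_nonneg (by positivity),
        inv_mul_le_iff₀ (Real.sqrt_pos.2 (hpos x))]
      simpa using hsq x
    have h1 := h φ ht
    rw [ibp (hu.of_le (by norm_cast)) hφcd hφcs, ← integral_neg] at h1
    have hpt : ∀ x, ‖fderiv ℝ u x‖ - (tsupport u).indicator (fun _ => τ) x ≤ - fderiv ℝ u x (φ x) := by
      intro x
      rw [hGi]
      simp only [φ, inner_smul_right, real_inner_self_eq_norm_sq]
      rw [← hGn]
      by_cases hx : x ∈ tsupport u
      · rw [indicator_of_mem hx]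
        have hs := Real.sqrt_pos.2 (hpos x)
        have e1 := hsq2 x
        have : ‖G x‖ - τ ≤ (Real.sqrt (‖G x‖ ^ 2 + τ ^ 2))⁻¹ * ‖G x‖ ^ 2 := by
          rw [le_inv_mul_iff₀ hs]
          by_cases h : τ ≤ ‖G x‖
          · nlinarith
          · nlinarith [norm_nonneg (G x), sq_nonneg ‖G x‖]
        simp only [q]; linarith
      · rw [indicator_of_notMem hx]
        have : fderiv ℝ u x = 0 := by
          by_contra h3
          exact hx (support_fderiv_subset ℝ h3)
        have : ‖G x‖ = 0 := by rw [hGn, this, norm_zero]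
        simp [this]
    have hKi : Integrable ((tsupport u).indicator (fun _ => τ)) := by
      rw [integrable_indicator_iff (isClosed_tsupport u).measurableSet]
      exact integrableOn_const (hs := (IsCompact.measure_lt_top hc).ne)
    have h2 := integral_mono (hintg.sub hKi) (g := fun x => - fderiv ℝ u x (φ x)) ?_ hpt
    · simp only [Pi.sub_apply] at h2
      rw [integral_sub hintg hKi, integral_indicator (isClosed_tsupport u).measurableSet,
        setIntegral_const, smul_eq_mul] at h2
      linarith
    · apply Continuous.integrable_of_hasCompactSupport
      · exact ((hu.continuous_fderiv (by simp)).clm_apply hφcd.continuous).neg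
      · apply hφcs.mono'
        intro x hx
        apply subset_tsupport
        intro h; apply hx; simp [h]
  have hK0 : 0 ≤ K := measureReal_nonneg
  refine le_of_forall_pos_le_add fun η hη => ?_
  have := key (η / (K + 1)) (by positivity)
  refine this.trans ?_
  gcongr
  rw [div_mul_eq_mul_div, div_le_iff₀ (by positivity)]
  nlinarith

variable {Ω : Set (EuclideanSpace ℝ (Fin n))}

lemma Sm_test {ε : ℝ} {φ : 𝔼 → 𝔼} (hφ : IsTest univ φ) : IsTest univ (Sm ε φ) :=
  ⟨Sm_contDiff ε hφ.cd.continuous.locallyIntegrable (m := 1), Sm_hcs hφ.cs, subset_univ _,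
    Sm_norm_le ε hφ.le⟩

lemma integral_Sm (hm : MeasurableSet Ω) (hb : Bornology.IsBounded Ω) (ε : ℝ)
    {φ : 𝔼 → 𝔼} (h : ContDiff ℝ 1 φ) (hc : HasCompactSupport φ) :
    ∫ x in Ω, vdiv (Sm ε φ) x = ∫ x, um Ω ε x * vdiv φ x := by
  rw [← ind_integral Ω hm]
  simp_rw [vdiv_Sm ε h hc]
  rw [← Sm_selfadj (ind_integrable hm hb) (vdiv_integrable h hc)]
  rfl

lemma um_tv (hm : MeasurableSet Ω) (hb : Bornology.IsBounded Ω) (hper : perimeter Ω ≠ ⊤) (ε : ℝ) :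
    ∫ x, ‖fderiv ℝ (um Ω ε) x‖ ≤ rP Ω univ := by
  refine integral_norm_fderiv_le (um_contDiff hm hb ε) (um_hcs hb ε) fun φ hφ => ?_
  rw [← integral_Sm hm hb ε hφ.cd hφ.cs]
  exact (Sm_test hφ).le_rP hper

lemma chain_ibp (hm : MeasurableSet Ω) (hb : Bornology.IsBounded Ω) (ε : ℝ)
    {g γ : ℝ → ℝ} (hg : ContDiff ℝ (⊤ : ℕ∞) g) (hγ : ∀ t, HasDerivAt g (γ t) t)
    {φ : 𝔼 → 𝔼} (h : ContDiff ℝ 1 φ) (hc : HasCompactSupport φ) :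
    ∫ x, g (um Ω ε x) * vdiv φ x = - ∫ x, γ (um Ω ε x) * fderiv ℝ (um Ω ε) x (φ x) := by
  have hu : ContDiff ℝ 1 (um Ω ε) := um_contDiff hm hb ε (m := 1)
  have hgu : ContDiff ℝ 1 (fun x => g (um Ω ε x)) :=
    (hg.of_le (by norm_cast)).comp hu
  rw [ibp hgu h hc]
  congr 2; ext x
  have := (hγ (um Ω ε x)).comp_hasFDerivAt x (hu.differentiable one_ne_zero x).hasFDerivAt
  have h2 : HasFDerivAt (fun x => g (um Ω ε x)) (γ (um Ω ε x) • fderiv ℝ (um Ω ε) x) x := this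
  rw [h2.fderiv]; simp

lemma key_id (hm : MeasurableSet Ω) (hb : Bornology.IsBounded Ω) (ε : ℝ)
    {g γ : ℝ → ℝ} (hg : ContDiff ℝ (⊤ : ℕ∞) g) (hγ : ∀ t, HasDerivAt g (γ t) t)
    (hγc : ContDiff ℝ 1 γ) {φ : 𝔼 → 𝔼} (h : ContDiff ℝ 1 φ) (hc : HasCompactSupport φ) :
    ∫ x in Ω, vdiv (Sm ε (fun x => γ (um Ω ε x) • φ x)) x = ∫ x, g (um Ω ε x) * vdiv φ x := by
  have hu : ContDiff ℝ 1 (um Ω ε) := um_contDiff hm hb ε (m := 1)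
  have h1 : ContDiff ℝ 1 (fun x => γ (um Ω ε x) • φ x) := (hγc.comp hu).smul h
  have h2 : HasCompactSupport (fun x => γ (um Ω ε x) • φ x) :=
    hc.smul_left (f := fun x => γ (um Ω ε x))
  rw [integral_Sm hm hb ε h1 h2, ibp hu h1 h2, chain_ibp hm hb ε hg hγ h hc]
  simp

lemma lim_g (hm : MeasurableSet Ω) (hb : Bornology.IsBounded Ω)
    {g : ℝ → ℝ} (hg : Continuous g) (hg0 : g 0 = 0)
    {φ : 𝔼 → 𝔼} (h : ContDiff ℝ 1 φ) (hc : HasCompactSupport φ) :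
    Tendsto (fun ε => ∫ x, g (um Ω ε x) * vdiv φ x) (𝓝[>] 0)
      (𝓝 (g 1 * ∫ x in Ω, vdiv φ x)) := by
  have := um_comp_tendsto hm hb hg (vdiv_integrable h hc)
  convert this using 2
  rw [← ind_integral Ω hm, ← integral_const_mul]
  congr 1; ext x
  by_cases hx : x ∈ Ω <;> simp [ind, hx, hg0]

/-- Points around which `Ω` has density close to one at scale `ε`. -/
def Wb (Ω : Set (EuclideanSpace ℝ (Fin n))) (ε s : ℝ) : Set (EuclideanSpace ℝ (Fin n)) :=
  (cthickening ε {x | um Ω ε x ≤ s})ᶜ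

lemma Wb_isOpen (ε s : ℝ) : IsOpen (Wb Ω ε s) := isClosed_cthickening.isOpen_compl

lemma mem_Wb {ε s : ℝ} (hε : 0 < ε) {y : 𝔼} (h : ∀ z, dist z y < 2 * ε → s < um Ω ε z) :
    y ∈ Wb Ω ε s := by
  intro hy
  have := cthickening_subset_thickening' (by linarith : 0 < 2 * ε) (by linarith : ε < 2 * ε) _ hy
  obtain ⟨z, hz, hz2⟩ := mem_thickening_iff.1 this
  have h3 := h z (by rwa [dist_comm])
  have : um Ω ε z ≤ s := hz
  linarith

lemma lemA (hm : MeasurableSet Ω) (hb : Bornology.IsBounded Ω) (hper : perimeter Ω ≠ ⊤)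
    {g γ : ℝ → ℝ} (hg : ContDiff ℝ (⊤ : ℕ∞) g) (hγ : ∀ t, HasDerivAt g (γ t) t)
    (hγc : ContDiff ℝ 1 γ) (hg0 : g 0 = 0) (hg1 : 0 ≤ g 1) (hγ0 : ∀ t, 0 ≤ γ t) (hγ1 : ∀ t, γ t ≤ 1)
    {s : ℝ} (hs : ∀ t, s ≤ t → γ t = 0) {V : Set 𝔼} (hV : IsOpen V) {η : ℝ} (hη : 0 < η) :
    ∀ᶠ ε in 𝓝[>] 0, rP Ω (Wb Ω ε s ∩ V) ≤ (1 - g 1) * rP Ω V + η := by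
  set ηPr := η / (2 * (g 1 + 1)) with hηPr
  have hηPr0 : 0 < ηPr := by positivity
  obtain ⟨φ, hφ, hφPr⟩ := exists_test (E := Ω) V hηPr0
  obtain ⟨δ, hδ, hδV⟩ := IsCompact.exists_cthickening_subset_open hφ.cs hV hφ.sub
  have hlim := lim_g hm hb hg.continuous hg0 hφ.cd hφ.cs
  have h1 : g 1 * rP Ω V - η < g 1 * ∫ x in Ω, vdiv φ x := by
    have : g 1 * (rP Ω V - ηPr) ≤ g 1 * ∫ x in Ω, vdiv φ x :=
      mul_le_mul_of_nonneg_left hφPr.le hg1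
    have : g 1 * ηPr < η := by
      rw [hηPr, mul_div_assoc', div_lt_iff₀ (by positivity)]; nlinarith
    nlinarith
  filter_upwards [hlim.eventually (lt_mem_nhds h1), self_mem_nhdsWithin,
    eventually_nhdsWithin_of_eventually_nhds (eventually_lt_nhds hδ)] with ε h2 hε hεδ
  have hε : 0 < ε := hε
  rw [← key_id hm hb ε hg hγ hγc hφ.cd hφ.cs] at h2
  have hu : ContDiff ℝ 1 (um Ω ε) := um_contDiff hm hb ε (m := 1)
  set f : 𝔼 → 𝔼 := fun x => γ (um Ω ε x) • φ x with hf
  have hfcd : ContDiff ℝ 1 f := (hγc.comp hu).smul hφ.cd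
  have hfcs : HasCompactSupport f := hφ.cs.smul_left (f := fun x => γ (um Ω ε x))
  have ht : IsTest (V \ Wb Ω ε s) (Sm ε f) := by
    refine ⟨Sm_contDiff ε hfcd.continuous.locallyIntegrable (m := 1), Sm_hcs hfcs, ?_, ?_⟩
    · have hsupp : tsupport (Sm ε f) ⊆
          cthickening ε (tsupport φ) ∩ cthickening ε {x | um Ω ε x ≤ s} := by
        refine closure_minimal ?_ (isClosed_cthickening.inter isClosed_cthickening)
        intro y hy
        have : ∃ t, dist t y < ε ∧ f t ≠ 0 := by
          by_contra! hcon
          exact hy (Sm_zero hε hcon)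
        obtain ⟨t, ht, hft⟩ := this
        constructor
        · apply thickening_subset_cthickening
          refine mem_thickening_iff.2 ⟨t, subset_tsupport _ ?_, by rwa [dist_comm]⟩
          intro h0; apply hft; simp [hf, h0]
        · apply thickening_subset_cthickening
          refine mem_thickening_iff.2 ⟨t, ?_, by rwa [dist_comm]⟩
          by_contra h0
          have h0 : s < um Ω ε t := not_le.1 h0
          apply hft; simp [hf, hs _ h0.le]
      intro y hy
      have := hsupp hy
      refine ⟨hδV (cthickening_mono hεδ.le _ this.1), fun h => h this.2⟩
    · apply Sm_norm_le
      intro x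
      simp only [hf]
      rw [norm_smul, Real.norm_of_nonneg (hγ0 _)]
      exact mul_le_one₀ (hγ1 _) (norm_nonneg _) (hφ.le _)
  have h3 := ht.le_rP hper
  have h4 : rP Ω (Wb Ω ε s ∩ V) + rP Ω (V \ Wb Ω ε s) ≤ rP Ω V := by
    refine rP_superadd hper ?_ inter_subset_right sdiff_subset
    rw [disjoint_left]
    exact fun x hx hx' => hx'.2 hx.1
  linarith

lemma lemUpper (hm : MeasurableSet Ω) (hb : Bornology.IsBounded Ω) (hper : perimeter Ω ≠ ⊤)
    {g γ : ℝ → ℝ} (hg : ContDiff ℝ (⊤ : ℕ∞) g) (hγ : ∀ t, HasDerivAt g (γ t) t)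
    (hγc : ContDiff ℝ 1 γ) (hg0 : g 0 = 0) (hg1 : 0 ≤ g 1) (hγ0 : ∀ t, 0 ≤ γ t)
    {η : ℝ} (hη : 0 < η) :
    ∀ᶠ ε in 𝓝[>] 0, ∫ x, (1 - γ (um Ω ε x)) * ‖fderiv ℝ (um Ω ε) x‖ ≤
      (1 - g 1) * rP Ω univ + η := by
  set ηPr := η / (2 * (g 1 + 1)) with hηPr
  have hηPr0 : 0 < ηPr := by positivity
  obtain ⟨φ, hφ, hφPr⟩ := exists_test (E := Ω) univ hηPr0
  have hlim := lim_g hm hb hg.continuous hg0 hφ.cd hφ.cs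
  have h1 : g 1 * rP Ω univ - η < g 1 * ∫ x in Ω, vdiv φ x := by
    have : g 1 * (rP Ω univ - ηPr) ≤ g 1 * ∫ x in Ω, vdiv φ x :=
      mul_le_mul_of_nonneg_left hφPr.le hg1
    have : g 1 * ηPr < η := by
      rw [hηPr, mul_div_assoc', div_lt_iff₀ (by positivity)]; nlinarith
    nlinarith
  filter_upwards [hlim.eventually (lt_mem_nhds h1)] with ε h2
  rw [chain_ibp hm hb ε hg hγ hφ.cd hφ.cs, ← integral_neg] at h2
  have hu : ContDiff ℝ 1 (um Ω ε) := um_contDiff hm hb ε (m := 1)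
  have hfc : Continuous (fderiv ℝ (um Ω ε)) := hu.continuous_fderiv one_ne_zero
  have hfs : HasCompactSupport (fderiv ℝ (um Ω ε)) := (um_hcs hb ε).fderiv ℝ
  have hgc : Continuous (fun x => γ (um Ω ε x)) := hγc.continuous.comp hu.continuous
  have i1 : Integrable (fun x => ‖fderiv ℝ (um Ω ε) x‖) :=
    hfc.norm.integrable_of_hasCompactSupport hfs.norm
  have i2 : Integrable (fun x => γ (um Ω ε x) * ‖fderiv ℝ (um Ω ε) x‖) :=
    (hgc.mul hfc.norm).integrable_of_hasCompactSupport hfs.norm.mul_left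
  have i3 : Integrable (fun x => -(γ (um Ω ε x) * fderiv ℝ (um Ω ε) x (φ x))) := by
    refine (hgc.mul (hfc.clm_apply hφ.cd.continuous)).neg.integrable_of_hasCompactSupport ?_
    apply hfs.mono'
    intro x hx
    apply subset_tsupport
    intro h; apply hx; simp [h]
  have h3 := integral_mono i3 i2 (fun x => by
    have : |fderiv ℝ (um Ω ε) x (φ x)| ≤ ‖fderiv ℝ (um Ω ε) x‖ := by
      rw [← Real.norm_eq_abs]
      exact (ContinuousLinearMap.le_opNorm _ _).trans
        (mul_le_of_le_one_right (norm_nonneg _) (hφ.le x))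
    have h5 := neg_abs_le (fderiv ℝ (um Ω ε) x (φ x))
    show -(γ (um Ω ε x) * fderiv ℝ (um Ω ε) x (φ x)) ≤ γ (um Ω ε x) * ‖fderiv ℝ (um Ω ε) x‖
    rw [← mul_neg]
    exact mul_le_mul_of_nonneg_left (by linarith) (hγ0 _))
  have h4 := um_tv hm hb hper ε
  simp_rw [sub_mul, one_mul]
  rw [integral_sub i1 i2]
  linarith

/-- The cutoff profile. -/
lemma exists_profile {δ : ℝ} (hδ : 0 < δ) (hδPr : δ < 1 / 2) :
    ∃ g γ : ℝ → ℝ, ContDiff ℝ (⊤ : ℕ∞) g ∧ (∀ t, HasDerivAt g (γ t) t) ∧ ContDiff ℝ (⊤ : ℕ∞) γ ∧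
      g 0 = 0 ∧ 1 - 2 * δ ≤ g 1 ∧ g 1 < 1 ∧ (∀ t, 0 ≤ γ t) ∧ (∀ t, γ t ≤ 1) ∧
      (∀ t, 1 - δ ≤ t → γ t = 0) ∧ (∀ t ≤ 1 - 2 * δ, g t = t) := by
  let γ : ℝ → ℝ := fun t => Real.smoothTransition ((1 - δ - t) / δ)
  have hγ : ContDiff ℝ (⊤ : ℕ∞) γ := by
    refine Real.smoothTransition.contDiff.comp ?_
    exact (contDiff_const.sub contDiff_id).div_const _
  have hγ0 : ∀ t, 0 ≤ γ t := fun t => Real.smoothTransition.nonneg _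
  have hγ1 : ∀ t, γ t ≤ 1 := fun t => Real.smoothTransition.le_one _
  have hγs : ∀ t, 1 - δ ≤ t → γ t = 0 := fun t ht =>
    Real.smoothTransition.zero_of_nonpos (div_nonpos_of_nonpos_of_nonneg (by linarith) hδ.le)
  have hγl : ∀ t, t ≤ 1 - 2 * δ → γ t = 1 := fun t ht =>
    Real.smoothTransition.one_of_one_le (by rw [le_div_iff₀ hδ]; linarith)
  let g : ℝ → ℝ := fun t => ∫ τ in (0:ℝ)..t, γ τ
  have hd : ∀ t, HasDerivAt g (γ t) t := fun t =>
    intervalIntegral.integral_hasDerivAt_right (hγ.continuous.intervalIntegrable _ _)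
      (hγ.continuous.stronglyMeasurableAtFilter _ _) hγ.continuous.continuousAt
  have hgl : ∀ t ≤ 1 - 2 * δ, g t = t := by
    intro t ht
    have : g t = ∫ τ in (0:ℝ)..t, (1:ℝ) := by
      apply intervalIntegral.integral_congr
      intro τ hτ
      apply hγl
      have := hτ.2
      rcases le_total 0 t with h | h
      · rw [max_eq_right h] at this; linarith
      · rw [max_eq_left h] at this; linarith
    rw [this]; simp
  have hdg : deriv g = γ := funext fun t => (hd t).deriv
  have hmono : Monotone g := monotone_of_deriv_nonneg (fun t => (hd t).differentiableAt)
    (fun t => by rw [hdg]; exact hγ0 t)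
  have hmono2 : Monotone (fun t => t - g t) := by
    refine monotone_of_deriv_nonneg (fun t => differentiableAt_id.sub (hd t).differentiableAt) ?_
    intro t
    have := ((hasDerivAt_id t).sub (hd t)).deriv
    have h2 : deriv (fun t => t - g t) t = 1 - γ t := this
    rw [h2]; linarith [hγ1 t]
  refine ⟨g, γ, ?_, hd, hγ, by simp [g], ?_, ?_, hγ0, hγ1, hγs, hgl⟩
  · rw [contDiff_infty_iff_deriv]
    exact ⟨fun t => (hd t).differentiableAt, hdg ▸ hγ⟩
  · have := hmono (show 1 - 2 * δ ≤ 1 by linarith)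
    rwa [hgl _ le_rfl] at this
  · have h1 : g 1 = g (1 - δ) := by
      have : g 1 - g (1 - δ) = ∫ τ in (1 - δ)..1, γ τ :=
        intervalIntegral.integral_interval_sub_left (hγ.continuous.intervalIntegrable _ _)
          (hγ.continuous.intervalIntegrable _ _)
      have h2 : ∫ τ in (1 - δ)..1, γ τ = ∫ τ in (1 - δ)..1, (0:ℝ) := by
        apply intervalIntegral.integral_congr
        intro τ hτ
        rw [uIcc_of_le (by linarith)] at hτ
        exact hγs _ hτ.1
      rw [h2] at this
      simp at this; linarith
    have h2 := hmono2 (show (0:ℝ) ≤ 1 - δ by linarith)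
    simp only [g, intervalIntegral.integral_same, sub_zero] at h2
    have : g (1 - δ) ≤ 1 - δ := by simp only [g]; linarith
    linarith

lemma lemA' (hm : MeasurableSet Ω) (hb : Bornology.IsBounded Ω) (hper : perimeter Ω ≠ ⊤)
    {δ : ℝ} (hδ : 0 < δ) (hδPr : δ < 1 / 2) {V : Set 𝔼} (hV : IsOpen V) {η : ℝ} (hη : 0 < η) :
    ∀ᶠ ε in 𝓝[>] 0, rP Ω (Wb Ω ε (1 - δ) ∩ V) ≤ 2 * δ * rP Ω V + η := by
  obtain ⟨g, γ, hg, hγ, hγc, hg0, hg1, -, hγ0, hγ1, hs, -⟩ := exists_profile hδ hδPr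
  filter_upwards [lemA hm hb hper hg hγ (hγc.of_le (by norm_cast)) hg0 (by linarith)
    hγ0 hγ1 hs hV hη] with ε h
  have := rP_nonneg Ω V
  nlinarith

/-- strict approximation by smooth functions of the mollified indicator, supported in high
density regions -/
lemma exists_h (hm : MeasurableSet Ω) (hb : Bornology.IsBounded Ω) (hper : perimeter Ω ≠ ⊤)
    {δ : ℝ} (hδ : 0 < δ) (hδPr : δ < 1 / 2) :
    ∃ h : ℝ → ℝ, ContDiff ℝ (⊤ : ℕ∞) h ∧ (∀ t ≤ 1 - 2 * δ, h t = 0) ∧ h 1 = 1 ∧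
      (∀ t ∈ Icc (0:ℝ) 1, h t ∈ Icc (0:ℝ) 1) ∧
      ∀ η > 0, ∀ᶠ ε in 𝓝[>] 0, ∫ x, ‖fderiv ℝ (fun x => h (um Ω ε x)) x‖ ≤ rP Ω univ + η := by
  obtain ⟨g, γ, hg, hγ, hγc, hg0, hg1, hg1', hγ0, hγ1, hs, hgl⟩ := exists_profile hδ hδPr
  set κ := 1 - g 1 with hκ
  have hκ0 : 0 < κ := by linarith
  let h : ℝ → ℝ := fun t => κ⁻¹ * (t - g t)
  have hd : ∀ t, HasDerivAt h (κ⁻¹ * (1 - γ t)) t := fun t =>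
    ((hasDerivAt_id t).sub (hγ t)).const_mul _
  have hmono : Monotone h := by
    refine monotone_of_deriv_nonneg (fun t => (hd t).differentiableAt) fun t => ?_
    rw [(hd t).deriv]
    exact mul_nonneg (inv_nonneg.2 hκ0.le) (by linarith [hγ1 t])
  have h00 : h 0 = 0 := by simp [h, hg0]
  have h11 : h 1 = 1 := by simp only [h]; rw [← hκ]; exact inv_mul_cancel₀ hκ0.ne'
  refine ⟨h, contDiff_const.mul (contDiff_id.sub hg), ?_, h11, ?_, ?_⟩
  · intro t ht; simp [h, hgl t ht]
  · intro t ht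
    exact ⟨h00 ▸ hmono ht.1, h11 ▸ hmono ht.2⟩
  · intro η hη
    filter_upwards [lemUpper hm hb hper hg hγ (hγc.of_le (by norm_cast)) hg0
      (by linarith) hγ0 (mul_pos hκ0 hη)] with ε hε
    have hu : ContDiff ℝ 1 (um Ω ε) := um_contDiff hm hb ε (m := 1)
    have e : ∀ x, ‖fderiv ℝ (fun x => h (um Ω ε x)) x‖ =
        κ⁻¹ * ((1 - γ (um Ω ε x)) * ‖fderiv ℝ (um Ω ε) x‖) := by
      intro x
      have := (hd (um Ω ε x)).comp_hasFDerivAt x (hu.differentiable one_ne_zero x).hasFDerivAt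
      have h2 : HasFDerivAt (fun x => h (um Ω ε x))
        ((κ⁻¹ * (1 - γ (um Ω ε x))) • fderiv ℝ (um Ω ε) x) x := this
      rw [h2.fderiv, norm_smul, Real.norm_of_nonneg
        (mul_nonneg (inv_nonneg.2 hκ0.le) (by linarith [hγ1 (um Ω ε x)])), mul_assoc]
    simp_rw [e]
    rw [integral_const_mul, inv_mul_le_iff₀ hκ0]
    linarith

end Key

/-! ### A relative isoperimetric inequality on balls -/

section Iso
variable {n : ℕ}

local notation "𝔼" => EuclideanSpace ℝ (Fin n)

lemma shift_deriv {Ω : Set 𝔼} (hm : MeasurableSet Ω) (hb : Bornology.IsBounded Ω)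
    {θ : 𝔼 → ℝ} (hθ : ContDiff ℝ 1 θ) (hc : HasCompactSupport θ) (h : 𝔼) :
    ∃ L : 𝔼 →L[ℝ] ℝ, HasFDerivAt (fun h => ∫ y in Ω, θ (y - h)) L h ∧
      ∀ v, L v = ∫ y in Ω, vdiv (fun y => (-θ (y - h)) • v) y := by
  let θPr : 𝔼 → ℝ := fun y => θ (-y)
  have h1 : ContDiff ℝ 1 θPr := hθ.comp contDiff_neg
  have hc' : HasCompactSupport θPr := hc.comp_homeomorph (Homeomorph.neg 𝔼)
  have hd := hc'.hasFDerivAt_convolution_right (ContinuousLinearMap.lsmul ℝ ℝ)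
    (ind_integrable hm hb).locallyIntegrable h1 h
  have hF : (fun h => ∫ y in Ω, θ (y - h)) = MeasureTheory.convolution (ind Ω) θPr
      (ContinuousLinearMap.lsmul ℝ ℝ) volume := by
    ext h
    rw [← ind_integral Ω hm, convolution_def]
    simp [θPr]
  rw [← hF] at hd
  refine ⟨_, hd, fun v => ?_⟩
  rw [convolution_def, ContinuousLinearMap.integral_apply, ← ind_integral Ω hm]
  · congr 1; ext t
    have e1 : fderiv ℝ θPr (h - t) v = - fderiv ℝ θ (t - h) v := by
      have : HasFDerivAt θPr ((fderiv ℝ θ (-(h - t))).comp (-(ContinuousLinearMap.id ℝ 𝔼))) (h - t) :=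
        ((hθ.differentiable one_ne_zero) (-(h-t))).hasFDerivAt.comp (h - t) (hasFDerivAt_id _).neg
      rw [this.fderiv, neg_sub]; simp
    have e2 : vdiv (fun y => (-θ (y - h)) • v) t = - fderiv ℝ θ (t - h) v := by
      have hd2 : HasFDerivAt (fun y => -θ (y - h)) (-(fderiv ℝ θ (t - h))) t := by
        have := ((hθ.differentiable one_ne_zero) (t - h)).hasFDerivAt.comp t
          ((hasFDerivAt_id t).sub_const h)
        exact this.neg
      rw [vdiv_smul hd2.differentiableAt (differentiableAt_const v), hd2.fderiv, vdiv_eq]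
      simp
    rw [e2, ← e1]
    simp [ContinuousLinearMap.precompR_apply]
  · exact (hc'.fderiv ℝ).convolutionExists_right _ (ind_integrable hm hb).locallyIntegrable
      (h1.continuous_fderiv one_ne_zero) h

lemma shift_le {Ω : Set 𝔼} (hm : MeasurableSet Ω) (hb : Bornology.IsBounded Ω)
    (hper : perimeter Ω ≠ ⊤)
    {θ : 𝔼 → ℝ} (hθ : ContDiff ℝ 1 θ) (hc : HasCompactSupport θ) (h0 : ∀ y, |θ y| ≤ 1)
    {x : 𝔼} {ρ s R : ℝ} (hx : ∀ y, ρ < dist y x → θ y = 0) (hR : ρ + s < R) {h : 𝔼} (hh : ‖h‖ < s) :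
    ∫ y in Ω, θ (y - h) ≤ (∫ y in Ω, θ y) + ‖h‖ * rP Ω (ball x R) := by
  have hs : 0 < s := (norm_nonneg h).trans_lt hh
  choose L hL hL2 using fun h => shift_deriv hm hb hθ hc h
  have key : ∀ z ∈ ball (0 : 𝔼) s, ‖L z‖ ≤ rP Ω (ball x R) := by
    intro z hz
    have hz : ‖z‖ < s := by simpa using hz
    have H : ∀ v, L z v ≤ ‖v‖ * rP Ω (ball x R) := by
      intro v
      rw [hL2]
      refine le_rP_scaled hper (norm_nonneg v) ?_ ?_ ?_ ?_
      · exact (hθ.comp (contDiff_id.sub contDiff_const)).neg.smul contDiff_const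
      · have : HasCompactSupport (fun y => -θ (y - z)) :=
          (hc.comp_homeomorph (Homeomorph.subRight z)).comp_left (g := fun t : ℝ => -t) (by simp)
        exact this.smul_right
      · have : closedBall x (ρ + s) ⊆ ball x R := closedBall_subset_ball hR
        refine Subset.trans ?_ this
        refine closure_minimal ?_ isClosed_closedBall
        intro y hy
        by_contra hcon
        apply hy
        have : θ (y - z) = 0 := by
          apply hx
          simp only [mem_closedBall, not_le] at hcon
          have h1 : dist y x ≤ dist (y - z) x + ‖z‖ := by
            have := dist_triangle y (y - z) x
            have e : dist y (y - z) = ‖z‖ := by simp [dist_eq_norm]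
            linarith
          linarith
        simp [this]
      · intro y
        rw [norm_smul, norm_neg]
        exact mul_le_of_le_one_left (norm_nonneg _) (h0 _)
    refine ContinuousLinearMap.opNorm_le_bound _ (rP_nonneg _ _) fun v => ?_
    rw [Real.norm_eq_abs, abs_le']
    refine ⟨by linarith [H v, mul_comm ‖v‖ (rP Ω (ball x R))], ?_⟩
    have := H (-v)
    rw [norm_neg, map_neg] at this
    linarith [mul_comm ‖v‖ (rP Ω (ball x R))]
  have := (convex_ball (0:𝔼) s).norm_image_sub_le_of_norm_hasFDerivWithin_le
    (fun z hz => (hL z).hasFDerivWithinAt) key (mem_ball_self hs) (y := h) (by simpa using hh)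
  simp only [sub_zero] at this
  have h3 := (le_abs_self _).trans this
  linarith [mul_comm ‖h‖ (rP Ω (ball x R))]

lemma iso_theta {Ω : Set 𝔼} (hm : MeasurableSet Ω) (hb : Bornology.IsBounded Ω)
    (hper : perimeter Ω ≠ ⊤)
    {θ : 𝔼 → ℝ} (hθ : ContDiff ℝ 1 θ) (hc : HasCompactSupport θ) (hp : ∀ y, 0 ≤ θ y)
    (h1 : ∀ y, θ y ≤ 1)
    {x : 𝔼} {r : ℝ} (hr : 0 < r) (hx : ∀ y, 3 / 2 * r < dist y x → θ y = 0) :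
    volume.real (Ω ∩ ball x r) * ∫ y, θ y ≤
      volume.real (ball (0:𝔼) (3 * r)) * ((∫ y in Ω, θ y) + 3 * r * rP Ω (ball x (5 * r))) := by
  have hlt : volume (Ω ∩ ball x r) < ⊤ := (hb.subset inter_subset_left).measure_lt_top
  have hlt2 : volume (ball (0:𝔼) (3 * r)) < ⊤ := measure_ball_lt_top
  have : IsFiniteMeasure (volume.restrict (Ω ∩ ball x r)) := ⟨by simpa using hlt⟩
  have : IsFiniteMeasure (volume.restrict (ball (0:𝔼) (3 * r))) := ⟨by simpa using hlt2⟩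
  have hcont : Continuous (Function.uncurry fun h y : 𝔼 => θ (y - h)) :=
    hθ.continuous.comp (continuous_snd.sub continuous_fst)
  have hintg : Integrable (Function.uncurry fun h y : 𝔼 => θ (y - h))
      ((volume.restrict (ball (0:𝔼) (3 * r))).prod (volume.restrict (Ω ∩ ball x r))) := by
    refine Integrable.of_bound hcont.aestronglyMeasurable 1 (Eventually.of_forall fun z => ?_)
    simp only [Function.uncurry]
    rw [Real.norm_of_nonneg (hp _)]; exact h1 _
  have hswap := integral_integral_swap hintg
  have hθi : Integrable θ := hθ.continuous.integrable_of_hasCompactSupport hc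
  -- lower bound
  have e1 : ∫ y in Ω ∩ ball x r, ∫ h in ball (0:𝔼) (3 * r), θ (y - h) =
      volume.real (Ω ∩ ball x r) * ∫ y, θ y := by
    rw [← smul_eq_mul (volume.real (Ω ∩ ball x r)), ← setIntegral_const]
    refine setIntegral_congr_fun (hm.inter measurableSet_ball) fun y hy => ?_
    have hy2 : dist y x < r := hy.2
    rw [← integral_sub_left_eq_self θ volume y]
    refine setIntegral_eq_integral_of_forall_compl_eq_zero fun h hh => ?_
    apply hx
    have hh : 3 * r ≤ ‖h‖ := by simpa using hh
    have h2 : ‖h‖ ≤ dist (y - h) x + dist y x := by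
      have := dist_triangle_right y (y - h) x
      have e : dist y (y - h) = ‖h‖ := by simp [dist_eq_norm]
      linarith
    linarith
  have e2 : ∫ h in ball (0:𝔼) (3 * r), ∫ y in Ω ∩ ball x r, θ (y - h) ≤
      ∫ h in ball (0:𝔼) (3 * r), ((∫ y in Ω, θ y) + 3 * r * rP Ω (ball x (5 * r))) := by
    refine setIntegral_mono_on hintg.integral_prod_left (integrable_const _) measurableSet_ball
      fun h hh => ?_
    have hh : ‖h‖ < 3 * r := by simpa using hh
    have a1 : ∫ y in Ω ∩ ball x r, θ (y - h) ≤ ∫ y in Ω, θ (y - h) :=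
      setIntegral_mono_set (hθi.comp_sub_right h).integrableOn
        (Eventually.of_forall fun y => hp _) (Eventually.of_forall inter_subset_left)
    have a2 := shift_le hm hb hper hθ hc (fun y => by rw [abs_of_nonneg (hp y)]; exact h1 y) hx
      (s := 3 * r) (R := 5 * r) (by linarith) hh
    have a3 : ‖h‖ * rP Ω (ball x (5 * r)) ≤ 3 * r * rP Ω (ball x (5 * r)) :=
      mul_le_mul_of_nonneg_right hh.le (rP_nonneg _ _)
    linarith
  rw [setIntegral_const, smul_eq_mul] at e2
  rw [← e1, ← hswap]
  exact e2

lemma iso {Ω : Set 𝔼} (hm : MeasurableSet Ω) (hb : Bornology.IsBounded Ω)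
    (hper : perimeter Ω ≠ ⊤) (x : 𝔼) {r : ℝ} (hr : 0 < r) :
    volume.real (Ω ∩ ball x r) * volume.real (ball x r \ Ω) ≤
      volume.real (ball (0:𝔼) (3 * r)) * (3 * r * rP Ω (ball x (5 * r))) := by
  set B := ball x r \ Ω with hB
  have hBm : MeasurableSet B := measurableSet_ball.diff hm
  have hBb : Bornology.IsBounded B := isBounded_ball.subset sdiff_subset
  have t0 := um_L1 hBm hBb continuous_id
  simp only [id] at t0
  have t1 : Tendsto (fun ε => volume.real (Ω ∩ ball x r) *
      (volume.real B - ∫ x, |um B ε x - ind B x|)) (𝓝[>] 0)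
      (𝓝 (volume.real (Ω ∩ ball x r) * (volume.real B - 0))) :=
    (tendsto_const_nhds.sub t0).const_mul _
  have t2 : Tendsto (fun ε => volume.real (ball (0:𝔼) (3 * r)) * ((∫ x, |um B ε x - ind B x|) +
      3 * r * rP Ω (ball x (5 * r)))) (𝓝[>] 0)
      (𝓝 (volume.real (ball (0:𝔼) (3 * r)) * (0 + 3 * r * rP Ω (ball x (5 * r))))) :=
    (t0.add tendsto_const_nhds).const_mul _
  have := le_of_tendsto_of_tendsto t1 t2 ?_
  · simpa using this
  have hev : ∀ᶠ ε in 𝓝[>] (0:ℝ), ε ∈ Ioo 0 (r / 2) := Ioo_mem_nhdsGT (by linarith)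
  filter_upwards [hev] with ε hε
  have hui : Integrable (um B ε) :=
    (um_contDiff hBm hBb ε (m := 1)).continuous.integrable_of_hasCompactSupport (um_hcs hBb ε)
  have hii := ind_integrable hBm hBb
  have hai : Integrable (fun x => |um B ε x - ind B x|) := (hui.sub hii).abs
  have h1 := iso_theta hm hb hper (um_contDiff hBm hBb ε (m := 1)) (um_hcs hBb ε)
    (um_nonneg B ε) (um_le B ε) hr (x := x) (by
      intro y hy
      refine Sm_zero hε.1 fun t ht => ?_
      have : t ∉ B := by
        intro h
        have h2 : dist t x < r := h.1
        have := dist_triangle y t x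
        rw [dist_comm y t] at this
        linarith [hε.2]
      simp [ind, this])
  have h2 : volume.real B - ∫ x, |um B ε x - ind B x| ≤ ∫ x, um B ε x := by
    have e : volume.real B = ∫ x, ind B x := by
      have := ind_integral B hBm (fun _ => 1)
      simpa using this.symm
    rw [e, ← integral_sub hii hai]
    refine integral_mono (hii.sub hai) hui fun y => ?_
    have := neg_abs_le (um B ε y - ind B y)
    simp only [Pi.sub_apply]; linarith
  have h3 : ∫ y in Ω, um B ε y ≤ ∫ x, |um B ε x - ind B x| := by
    rw [← ind_integral Ω hm]
    refine integral_mono_of_nonneg (Eventually.of_forall fun y =>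
      mul_nonneg (ind_nonneg _ _) (um_nonneg _ _ _)) hai (Eventually.of_forall fun y => ?_)
    by_cases hy : y ∈ Ω
    · have : y ∉ B := fun h => h.2 hy
      simp [ind, hy, this, le_abs_self]
    · simp [ind, hy]
  refine (mul_le_mul_of_nonneg_left h2 measureReal_nonneg).trans (h1.trans ?_)
  exact mul_le_mul_of_nonneg_left (by linarith) measureReal_nonneg

end Iso

/-! ### Coverings by small balls -/

section Covering
variable {n : ℕ}

local notation "𝔼" => EuclideanSpace ℝ (Fin n)

/-- volume of the unit ball, as a real number -/
def vB (n : ℕ) : ℝ := volume.real (ball (0 : EuclideanSpace ℝ (Fin n)) 1)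

lemma vB_pos : 0 < vB n :=
  ENNReal.toReal_pos (measure_ball_pos volume _ one_pos).ne' measure_ball_lt_top.ne

lemma vol_cball (x : 𝔼) {r : ℝ} (hr : 0 ≤ r) : volume.real (closedBall x r) = r ^ n * vB n := by
  rw [Measure.addHaar_real_closedBall volume x hr]; simp [vB]

lemma vol_ball (x : 𝔼) {r : ℝ} (hr : 0 < r) : volume.real (ball x r) = r ^ n * vB n := by
  rw [← vol_cball x hr.le, measureReal_def, measureReal_def,
    Measure.addHaar_closedBall volume x hr.le, Measure.addHaar_ball_of_pos volume x hr]

/-- complement volume -/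
def cv (Ω : Set (EuclideanSpace ℝ (Fin n))) (x : EuclideanSpace ℝ (Fin n)) (r : ℝ) : ℝ :=
  volume.real (ball x r \ Ω)

lemma cv_nonneg (Ω : Set 𝔼) (x : 𝔼) (r : ℝ) : 0 ≤ cv Ω x r := measureReal_nonneg

lemma cv_mono (Ω : Set 𝔼) {x y : 𝔼} {r s : ℝ} (h : ball x r ⊆ ball y s) : cv Ω x r ≤ cv Ω y s :=
  measureReal_mono (sdiff_subset_sdiff_left h)
    ((measure_mono sdiff_subset).trans_lt measure_ball_lt_top).ne

lemma iso' (hn : 2 ≤ n) {Ω : Set 𝔼} (hm : MeasurableSet Ω) (hb : Bornology.IsBounded Ω)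
    (hper : perimeter Ω ≠ ⊤) {x : 𝔼} {r α : ℝ} (hr : 0 < r) (hα : 0 < α)
    (h1 : α * (r ^ n * vB n) ≤ cv Ω x r) (h2 : cv Ω x r ≤ 1 / 2 * (r ^ n * vB n)) :
    r ^ (n - 1) ≤ 2 * 3 ^ (n + 1) / (vB n) / α * rP Ω (ball x (5 * r)) := by
  have h := iso hm hb hper x hr
  have hv := vB_pos (n := n)
  set p := rP Ω (ball x (5 * r))
  set w := vB n
  have e1 : volume.real (Ω ∩ ball x r) = r ^ n * w - cv Ω x r := by
    rw [← vol_ball x hr, cv, eq_sub_iff_add_eq, inter_comm]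
    exact measureReal_inter_add_sdiff hm
  rw [e1, vol_ball _ (by linarith : 0 < 3 * r)] at h
  change (r ^ n * w - cv Ω x r) * cv Ω x r ≤ _ at h
  have hrn : 0 < r ^ n * w := by positivity
  have h3 : (1 / 2 * (r ^ n * w)) * (α * (r ^ n * w)) ≤ (3 * r) ^ n * w * (3 * r * p) :=
    (mul_le_mul (by linarith) h1 (by positivity) (by linarith)).trans h
  have e2 : r ^ n = r ^ (n - 1) * r := by rw [← pow_succ]; congr 1; omega
  have h4 : (r ^ n * w * r) * (α * w * r ^ (n - 1)) ≤ (r ^ n * w * r) * (2 * 3 ^ (n + 1) * p) := by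
    calc (r ^ n * w * r) * (α * w * r ^ (n - 1)) =
        2 * ((1 / 2 * (r ^ n * w)) * (α * ((r ^ (n - 1) * r) * w))) := by ring
      _ ≤ 2 * ((3 * r) ^ n * w * (3 * r * p)) := by rw [← e2]; linarith
      _ = _ := by rw [mul_pow]; ring
  have h5 := le_of_mul_le_mul_left h4 (by positivity)
  rw [div_div, div_mul_eq_mul_div, le_div_iff₀ (by positivity)]
  linarith

/-- `N` can be covered by small open balls with total `(n-1)`-content at most `η`. -/
def Cov (η : ℝ≥0∞) (N : Set (EuclideanSpace ℝ (Fin n))) : Prop :=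
  ∃ S : Set (EuclideanSpace ℝ (Fin n) × ℝ), (∀ p ∈ S, 0 < p.2 ∧ p.2 ≤ 1) ∧
    N ⊆ ⋃ p ∈ S, ball p.1 p.2 ∧ ∑' p : S, ENNReal.ofReal (p.1.2 ^ (n - 1)) ≤ η

lemma Cov.mono {a b : ℝ≥0∞} {N M : Set 𝔼} (h : Cov a N) (hab : a ≤ b) (hM : M ⊆ N) : Cov b M := by
  obtain ⟨S, h1, h2, h3⟩ := h
  exact ⟨S, h1, hM.trans h2, h3.trans hab⟩

lemma Cov.union {a b : ℝ≥0∞} {N M : Set 𝔼} (h : Cov a N) (h' : Cov b M) : Cov (a + b) (N ∪ M) := by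
  obtain ⟨S, h1, h2, h3⟩ := h
  obtain ⟨T, g1, g2, g3⟩ := h'
  refine ⟨S ∪ T, ?_, ?_, ?_⟩
  · rintro p (hp | hp)
    exacts [h1 p hp, g1 p hp]
  · rw [biUnion_union]; exact union_subset_union h2 g2
  · exact (ENNReal.tsum_union_le (fun p : 𝔼 × ℝ => ENNReal.ofReal (p.2 ^ (n - 1))) S T).trans
      (add_le_add h3 g3)

lemma Cov.of_family {ι : Type*} (K : Set ι) (x : ι → 𝔼) (R : ι → ℝ) {N : Set 𝔼} {a : ℝ≥0∞}
    (hR : ∀ i ∈ K, 0 < R i ∧ R i ≤ 1) (hN : N ⊆ ⋃ i ∈ K, ball (x i) (R i))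
    (hs : ∑' i : K, ENNReal.ofReal (R i ^ (n - 1)) ≤ a) : Cov a N := by
  refine ⟨⋃ i ∈ K, {(x i, R i)}, ?_, ?_, ?_⟩
  · intro p hp
    simp only [mem_iUnion, mem_singleton_iff] at hp
    obtain ⟨i, hi, rfl⟩ := hp
    exact hR i hi
  · intro y hy
    obtain ⟨i, hi, hy⟩ := mem_iUnion₂.1 (hN hy)
    refine mem_iUnion₂.2 ⟨(x i, R i), ?_, hy⟩
    exact mem_iUnion₂.2 ⟨i, hi, rfl⟩
  · refine (ENNReal.tsum_biUnion_le_tsum (fun p : 𝔼 × ℝ => ENNReal.ofReal (p.2 ^ (n - 1))) K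
      (fun i => {(x i, R i)})).trans ?_
    refine le_trans (le_of_eq ?_) hs
    refine tsum_congr fun i => ?_
    rw [tsum_singleton (x i, R i) (fun p : 𝔼 × ℝ => ENNReal.ofReal (p.2 ^ (n - 1)))]

/-- null sets for the content -/
def NullC (N : Set (EuclideanSpace ℝ (Fin n))) : Prop := ∀ η : ℝ≥0∞, 0 < η → Cov η N

lemma NullC.iUnion {N : ℕ → Set 𝔼} (h : ∀ k, NullC (N k)) : NullC (⋃ k, N k) := by
  intro η hη
  obtain ⟨e, he, hs⟩ := ENNReal.exists_pos_sum_of_countable' hη.ne' ℕ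
  choose S h1 h2 h3 using fun k => h k (e k) (he k)
  refine ⟨⋃ k, S k, ?_, ?_, ?_⟩
  · intro p hp
    obtain ⟨k, hk⟩ := mem_iUnion.1 hp
    exact h1 k p hk
  · intro y hy
    obtain ⟨k, hk⟩ := mem_iUnion.1 hy
    obtain ⟨p, hp, hy⟩ := mem_iUnion₂.1 (h2 k hk)
    exact mem_iUnion₂.2 ⟨p, mem_iUnion.2 ⟨k, hp⟩, hy⟩
  · exact (ENNReal.tsum_iUnion_le_tsum (fun p : 𝔼 × ℝ => ENNReal.ofReal (p.2 ^ (n - 1))) S).trans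
      ((ENNReal.tsum_le_tsum h3).trans hs.le)

lemma vitali_cov {Ω : Set 𝔼} (hper : perimeter Ω ≠ ⊤) {A W : Set 𝔼} {C : ℝ} (hC : 0 ≤ C)
    (h : ∀ x ∈ A, ∃ r, 0 < r ∧ r ≤ 1 / 21 ∧ ball x (5 * r) ⊆ W ∧
      r ^ (n - 1) ≤ C * rP Ω (ball x (5 * r))) :
    Cov (ENNReal.ofReal (21 ^ (n - 1) * C * rP Ω W)) A := by
  classical
  have h' : ∀ x, ∃ r, x ∈ A → 0 < r ∧ r ≤ 1 / 21 ∧ ball x (5 * r) ⊆ W ∧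
      r ^ (n - 1) ≤ C * rP Ω (ball x (5 * r)) := by
    intro x
    by_cases hx : x ∈ A
    · obtain ⟨r, hr⟩ := h x hx; exact ⟨r, fun _ => hr⟩
    · exact ⟨0, fun h => absurd h hx⟩
  choose r hr using h'
  obtain ⟨u, huA, hud, huc⟩ := Vitali.exists_disjoint_subfamily_covering_enlargement_closedBall
    A id (fun x => 5 * r x) 1 (fun a ha => by linarith [(hr a ha).2.1]) 4 (by norm_num)
  refine Cov.of_family u id (fun x => 21 * r x) ?_ ?_ ?_
  · intro i hi
    have := hr i (huA hi)
    exact ⟨by linarith, by linarith⟩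
  · intro y hy
    obtain ⟨b, hb, hy2⟩ := huc y hy
    refine mem_iUnion₂.2 ⟨b, hb, ?_⟩
    have h1 := hr y hy
    have h2 := hr b (huA hb)
    have h3 := hy2 (mem_closedBall_self (by linarith))
    refine closedBall_subset_ball ?_ h3
    linarith
  · rw [ENNReal.tsum_eq_iSup_sum]
    refine iSup_le fun s => ?_
    rw [← ENNReal.ofReal_sum_of_nonneg (fun i _ => by
      have := hr i (huA i.2)
      exact pow_nonneg (by linarith) _)]
    apply ENNReal.ofReal_le_ofReal
    have h1 := rP_sum_le hper s (fun i : u => ball (i : 𝔼) (5 * r i)) (W := W) (by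
      intro i _ j _ hij
      have := hud i.2 j.2 (fun h => hij (Subtype.ext h))
      exact this.mono ball_subset_closedBall ball_subset_closedBall)
      (fun i _ => (hr i (huA i.2)).2.2.1)
    calc ∑ i ∈ s, (21 * r i) ^ (n - 1) ≤ ∑ i ∈ s, 21 ^ (n - 1) * C * rP Ω (ball (i : 𝔼) (5 * r i)) := by
          refine Finset.sum_le_sum fun i _ => ?_
          rw [mul_pow, mul_assoc]
          exact mul_le_mul_of_nonneg_left (hr i (huA i.2)).2.2.2 (by positivity)
      _ = 21 ^ (n - 1) * C * ∑ i ∈ s, rP Ω (ball (i : 𝔼) (5 * r i)) := by rw [Finset.mul_sum]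
      _ ≤ _ := mul_le_mul_of_nonneg_left h1 (by positivity)

lemma null_of_hausdorff (hn : 2 ≤ n) {Z : Set 𝔼} (hZ : μH[(n : ℝ) - 1] Z = 0) : NullC Z := by
  intro η hη
  have hη2 : 0 < η / 2 := ENNReal.half_pos hη.ne'
  obtain ⟨e, he, hs⟩ := ENNReal.exists_pos_sum_of_countable hη2.ne' ℕ
  rw [Measure.hausdorffMeasure_apply] at hZ
  have h0 : (⨅ (t : ℕ → Set 𝔼) (_ : Z ⊆ ⋃ n, t n) (_ : ∀ n, ediam (t n) ≤ ENNReal.ofReal (1/2)),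
          ∑' k, ⨆ _ : (t k).Nonempty, ediam (t k) ^ ((n : ℝ) - 1)) < η / 2 := by
    refine lt_of_le_of_lt ?_ hη2
    rw [← hZ]
    exact le_iSup₂_of_le (ENNReal.ofReal (1/2)) (by simp) le_rfl
  simp only [iInf_lt_iff] at h0
  obtain ⟨t, ht, hd, hsum⟩ := h0
  have hex : ∀ k, ∃ x : 𝔼, ∃ ρ : ℝ, (t k).Nonempty → 0 < ρ ∧ ρ ≤ 1 ∧ t k ⊆ ball x ρ ∧
      ENNReal.ofReal (ρ ^ (n - 1)) ≤ ediam (t k) ^ ((n : ℝ) - 1) + e k := by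
    intro k
    by_cases hk : (t k).Nonempty
    · obtain ⟨x, hx⟩ := hk
      have hDt : ediam (t k) ≠ ⊤ := ne_top_of_le_ne_top ENNReal.ofReal_ne_top (hd k)
      set D := (ediam (t k)).toReal with hD
      have hD0 : 0 ≤ D := ENNReal.toReal_nonneg
      have hD1 : D ≤ 1 / 2 := ENNReal.toReal_le_of_le_ofReal (by norm_num) (hd k)
      have hc : Tendsto (fun ρ : ℝ => ρ ^ (n - 1)) (𝓝[>] D) (𝓝 (D ^ (n - 1))) :=
        ((continuous_pow (n - 1)).tendsto D).mono_left nhdsWithin_le_nhds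
      have h1 := hc.eventually_lt_const (u := D ^ (n - 1) + e k) (by
        have : (0:ℝ) < e k := by exact_mod_cast he k
        linarith)
      have h2 : ∀ᶠ ρ in 𝓝[>] D, ρ ∈ Ioo D 1 := Ioo_mem_nhdsGT (by linarith)
      obtain ⟨ρ, hρ1, hρ2⟩ := (h1.and h2).exists
      refine ⟨x, ρ, fun _ => ⟨by linarith [hρ2.1], hρ2.2.le, ?_, ?_⟩⟩
      · intro y hy
        have : edist y x ≤ ediam (t k) := edist_le_ediam_of_mem hy hx
        rw [mem_ball, dist_edist]
        exact (ENNReal.toReal_mono hDt this).trans_lt hρ2.1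
      · have e1 : ediam (t k) ^ ((n : ℝ) - 1) = ENNReal.ofReal (D ^ (n - 1)) := by
          rw [← ENNReal.ofReal_toReal hDt, ← hD]
          have : (n : ℝ) - 1 = ((n - 1 : ℕ) : ℝ) := by
            rw [Nat.cast_sub (by omega)]; simp
          rw [this, ENNReal.rpow_natCast, ENNReal.ofReal_pow hD0]
        rw [e1, ← ENNReal.ofReal_coe_nnreal, ← ENNReal.ofReal_add (by positivity) (by positivity)]
        exact ENNReal.ofReal_le_ofReal hρ1.le
    · exact ⟨0, 0, fun h => absurd h hk⟩
  choose x ρ hx using hex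
  refine Cov.of_family {k | (t k).Nonempty} x ρ (fun k hk => ⟨(hx k hk).1, (hx k hk).2.1⟩) ?_ ?_
  · intro y hy
    obtain ⟨k, hk⟩ := mem_iUnion.1 (ht hy)
    exact mem_iUnion₂.2 ⟨k, ⟨y, hk⟩, (hx k ⟨y, hk⟩).2.2.1 hk⟩
  · calc ∑' k : {k | (t k).Nonempty}, ENNReal.ofReal (ρ k ^ (n - 1))
        ≤ ∑' k : {k | (t k).Nonempty},
          ((⨆ _ : (t k).Nonempty, ediam (t k) ^ ((n : ℝ) - 1)) + e k) := by
          refine ENNReal.tsum_le_tsum fun k => ?_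
          have : (⨆ _ : (t k).Nonempty, ediam (t k) ^ ((n : ℝ) - 1)) =
            ediam (t k) ^ ((n : ℝ) - 1) := iSup_pos k.2
          rw [this]
          exact (hx k k.2).2.2.2
      _ ≤ ∑' k : ℕ, ((⨆ _ : (t k).Nonempty, ediam (t k) ^ ((n : ℝ) - 1)) + e k) :=
          ENNReal.tsum_comp_le_tsum_of_injective Subtype.val_injective
            (fun k : ℕ => (⨆ _ : (t k).Nonempty, ediam (t k) ^ ((n : ℝ) - 1)) + (e k : ℝ≥0∞))
      _ = (∑' k : ℕ, (⨆ _ : (t k).Nonempty, ediam (t k) ^ ((n : ℝ) - 1))) + ∑' k, (e k : ℝ≥0∞) :=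
          ENNReal.tsum_add
      _ ≤ η / 2 + η / 2 := add_le_add hsum.le hs.le
      _ = η := ENNReal.add_halves η

end Covering

/-! ### Covering the bad set -/

section Bad
variable {n : ℕ}

local notation "𝔼" => EuclideanSpace ℝ (Fin n)

lemma one_sub_um {Ω : Set 𝔼} (hm : MeasurableSet Ω) (ε : ℝ) (x : 𝔼) :
    1 - um Ω ε x = ∫ t in Ωᶜ, mol n ε (x - t) := by
  have hi : Integrable (fun t => mol n ε (x - t)) := (mol_integrable ε).comp_sub_left x
  have h1 : ∫ t, mol n ε (x - t) = 1 := by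
    rw [integral_sub_left_eq_self (mol n ε) volume x, mol_integral]
  have h2 : um Ω ε x = ∫ t in Ω, mol n ε (x - t) := by
    rw [← ind_integral Ω hm]
    unfold um
    rw [Sm_apply']
    simp [mul_comm]
  rw [h2, ← h1, ← integral_add_compl hm hi]
  ring

lemma one_sub_um_le {Ω : Set 𝔼} (hm : MeasurableSet Ω) {ε : ℝ} (hε : 0 < ε) (x : 𝔼) :
    (1 - um Ω ε x) * ((ε / 2) ^ n * vB n) ≤ cv Ω x ε := by
  rw [one_sub_um hm, ← vol_cball (0 : 𝔼) (by positivity)]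
  have hpos : 0 < volume.real (closedBall (0:𝔼) (ε / 2)) := by
    rw [vol_cball _ (by positivity)]; have := vB_pos (n := n); positivity
  rw [← le_div_iff₀ hpos]
  have hi : Integrable (fun t => mol n ε (x - t)) := (mol_integrable ε).comp_sub_left x
  have e : ∫ t in Ωᶜ, mol n ε (x - t) = ∫ t in ball x ε \ Ω, mol n ε (x - t) := by
    refine setIntegral_eq_of_subset_of_forall_sdiff_eq_zero hm.compl (fun y hy => hy.2) ?_
    intro t ht
    apply mol_zero hε
    by_contra hlt
    rw [not_le] at hlt
    exact ht.2 ⟨by rwa [mem_ball, dist_comm, dist_eq_norm], ht.1⟩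
  rw [e]
  have hfin : volume (ball x ε \ Ω) < ⊤ := (measure_mono sdiff_subset).trans_lt measure_ball_lt_top
  calc ∫ t in ball x ε \ Ω, mol n ε (x - t)
      ≤ ∫ t in ball x ε \ Ω, 1 / volume.real (closedBall (0 : 𝔼) (ε / 2)) :=
        setIntegral_mono hi.integrableOn (integrableOn_const (hs := hfin.ne)) fun t => mol_le hε _
    _ = _ := by
        rw [setIntegral_const, smul_eq_mul, cv]; ring

lemma cv_le_one_sub_um {Ω : Set 𝔼} (hm : MeasurableSet Ω) {ε : ℝ} (hε : 0 < ε) (x : 𝔼) :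
    cv Ω x (ε / 2) ≤ (1 - um Ω ε x) * (ε ^ n * vB n) := by
  rw [one_sub_um hm, ← vol_cball (0 : 𝔼) (by positivity)]
  have hpos : 0 < volume.real (closedBall (0:𝔼) ε) := by
    rw [vol_cball _ (by positivity)]; have := vB_pos (n := n); positivity
  rw [← div_le_iff₀ hpos]
  have hi : Integrable (fun t => mol n ε (x - t)) := (mol_integrable ε).comp_sub_left x
  have hfin : volume (ball x (ε / 2) \ Ω) < ⊤ :=
    (measure_mono sdiff_subset).trans_lt measure_ball_lt_top
  calc cv Ω x (ε / 2) / volume.real (closedBall (0:𝔼) ε)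
      = ∫ t in ball x (ε / 2) \ Ω, 1 / volume.real (closedBall (0 : 𝔼) ε) := by
        rw [setIntegral_const, smul_eq_mul, cv]; ring
    _ ≤ ∫ t in ball x (ε / 2) \ Ω, mol n ε (x - t) := by
        refine setIntegral_mono_on (integrableOn_const (hs := hfin.ne)) hi.integrableOn
          (measurableSet_ball.diff hm) fun t ht => mol_ge hε ?_
        have : dist t x < ε / 2 := ht.1
        rw [← dist_eq_norm, dist_comm]; exact this.le
    _ ≤ ∫ t in Ωᶜ, mol n ε (x - t) :=
        setIntegral_mono_set hi.integrableOn (Eventually.of_forall fun t => mol_nonneg _ _)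
          (Eventually.of_forall fun y hy => hy.2)

/-- points with small complement density at all scales below `ρ` -/
def Ac (Ω : Set (EuclideanSpace ℝ (Fin n))) (c ρ : ℝ) : Set (EuclideanSpace ℝ (Fin n)) :=
  {x | ∀ r, 0 < r → r < ρ → cv Ω x r ≤ c * (r ^ n * vB n)}

lemma lt_um {Ω : Set 𝔼} (hm : MeasurableSet Ω) {ε δ : ℝ} (hε : 0 < ε) {z : 𝔼}
    (h : cv Ω z ε < δ * ((ε / 2) ^ n * vB n)) : 1 - δ < um Ω ε z := by
  have h1 := (one_sub_um_le hm hε z).trans_lt h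
  have hv := vB_pos (n := n)
  have := lt_of_mul_lt_mul_right h1 (by positivity)
  linarith

lemma Ac_null {Ω : Set 𝔼} (hm : MeasurableSet Ω) (hb : Bornology.IsBounded Ω)
    (hper : perimeter Ω ≠ ⊤) {c ρ : ℝ} (hc : c * 6 ^ n < 1 / 4) (hρ : 0 < ρ)
    {η : ℝ} (hη : 0 < η) : ∃ V, IsOpen V ∧ Ac Ω c ρ ⊆ V ∧ rP Ω V ≤ η := by
  have hv := vB_pos (n := n)
  let T : Set ℝ := {p | ∃ V, IsOpen V ∧ Ac Ω c ρ ⊆ V ∧ rP Ω V = p}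
  have hT : T.Nonempty := ⟨_, univ, isOpen_univ, subset_univ _, rfl⟩
  have hTb : BddBelow T := ⟨0, by rintro p ⟨V, -, -, rfl⟩; exact rP_nonneg _ _⟩
  set m := sInf T with hmdef
  have hstep : ∀ κ > 0, m ≤ 1 / 2 * (m + κ) + κ := by
    intro κ hκ
    obtain ⟨p, ⟨V, hV, hAV, rfl⟩, hp⟩ := exists_lt_of_csInf_lt hT (by linarith : sInf T < m + κ)
    have h1 := lemA' hm hb hper (δ := 1 / 4) (by norm_num) (by norm_num) hV hκ
    have h2 : ∀ᶠ ε in 𝓝[>] (0:ℝ), ε ∈ Ioo 0 (ρ / 3) := Ioo_mem_nhdsGT (by linarith)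
    obtain ⟨ε, hε1, hε⟩ := (h1.and h2).exists
    have hmem : rP Ω (Wb Ω ε (1 - 1 / 4) ∩ V) ∈ T := by
      refine ⟨_, (Wb_isOpen _ _).inter hV, subset_inter ?_ hAV, rfl⟩
      intro y hy
      refine mem_Wb hε.1 fun z hz => lt_um hm hε.1 ?_
      have h3 : cv Ω z ε ≤ cv Ω y (3 * ε) := cv_mono Ω (ball_subset_ball' (by linarith))
      have h4 := hy (3 * ε) (by linarith [hε.1]) (by linarith [hε.2])
      have e : (3 * ε) ^ n = 6 ^ n * (ε / 2) ^ n := by rw [← mul_pow]; ring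
      have h5 : 0 < (ε / 2) ^ n * vB n := by have := hε.1; positivity
      calc cv Ω z ε ≤ c * ((3 * ε) ^ n * vB n) := h3.trans h4
        _ = c * 6 ^ n * ((ε / 2) ^ n * vB n) := by rw [e]; ring
        _ < _ := mul_lt_mul_of_pos_right hc h5
    have := csInf_le hTb hmem
    linarith
  have hm0 : m ≤ 0 := by
    by_contra hcon
    rw [not_le] at hcon
    have := hstep (m / 8) (by linarith)
    linarith
  obtain ⟨p, ⟨V, hV, hAV, rfl⟩, hp⟩ := exists_lt_of_csInf_lt hT (by linarith : sInf T < η)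
  exact ⟨V, hV, hAV, hp.le⟩

lemma Ac_freq_null (hn : 2 ≤ n) {Ω : Set 𝔼} (hm : MeasurableSet Ω) (hb : Bornology.IsBounded Ω)
    (hper : perimeter Ω ≠ ⊤) {c ρ α : ℝ} (hc : c * 6 ^ n < 1 / 4) (hc2 : c ≤ 1 / 2) (hρ : 0 < ρ)
    (hα : 0 < α) :
    NullC {x | x ∈ Ac Ω c ρ ∧ ∃ᶠ r in 𝓝[>] (0:ℝ), α * (r ^ n * vB n) ≤ cv Ω x r} := by
  intro η hη
  have hv := vB_pos (n := n)
  set C := 2 * 3 ^ (n + 1) / (vB n) / α with hC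
  have hC0 : 0 < C := by positivity
  obtain ⟨e, he0, he⟩ : ∃ e : ℝ, 0 < e ∧ ENNReal.ofReal e ≤ η := by
    obtain ⟨q, hq0, hq⟩ := ENNReal.lt_iff_exists_nnreal_btwn.1 hη
    exact ⟨q, by exact_mod_cast hq0, by simpa using hq.le⟩
  obtain ⟨V, hV, hAV, hVp⟩ := Ac_null hm hb hper hc hρ (η := e / (21 ^ (n - 1) * C)) (by positivity)
  have := vitali_cov hper (W := V) (A := {x | x ∈ Ac Ω c ρ ∧ ∃ᶠ r in 𝓝[>] (0:ℝ),
    α * (r ^ n * vB n) ≤ cv Ω x r}) hC0.le ?_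
  · refine this.mono (le_trans (ENNReal.ofReal_le_ofReal ?_) he) Subset.rfl
    rw [le_div_iff₀ (by positivity)] at hVp
    linarith
  · rintro x ⟨hxA, hx⟩
    obtain ⟨s, hs, hsV⟩ := Metric.isOpen_iff.1 hV x (hAV hxA)
    have h2 : ∀ᶠ r in 𝓝[>] (0:ℝ), r ∈ Ioo 0 (min (min ρ (1/21)) (s / 5)) :=
      Ioo_mem_nhdsGT (by positivity)
    obtain ⟨r, hr1, hr0, hr2⟩ := (hx.and_eventually h2).exists
    have hrρ : r < ρ := hr2.trans_le ((min_le_left _ _).trans (min_le_left _ _))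
    have hr21 : r < 1 / 21 := hr2.trans_le ((min_le_left _ _).trans (min_le_right _ _))
    have hrs : r < s / 5 := hr2.trans_le (min_le_right _ _)
    refine ⟨r, hr0, hr21.le, (ball_subset_ball (by linarith)).trans hsV, ?_⟩
    refine iso' hn hm hb hper hr0 hα hr1 ((hxA r hr0 hrρ).trans ?_)
    exact mul_le_mul_of_nonneg_right hc2 (by positivity)

lemma vol_inter {Ω : Set 𝔼} (hm : MeasurableSet Ω) (x : 𝔼) {r : ℝ} (hr : 0 < r) :
    volume.real (Ω ∩ ball x r) = r ^ n * vB n - cv Ω x r := by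
  rw [← vol_ball x hr, cv, eq_sub_iff_add_eq, inter_comm]
  exact measureReal_inter_add_sdiff hm

lemma ratio_eq {Ω : Set 𝔼} (hm : MeasurableSet Ω) (x : 𝔼) {r : ℝ} (hr : 0 < r) :
    volume (Ω ∩ ball x r) / volume (ball x r) =
      ENNReal.ofReal (1 - cv Ω x r / (r ^ n * vB n)) := by
  have hv := vB_pos (n := n)
  have h1 : volume (Ω ∩ ball x r) ≠ ⊤ :=
    ((measure_mono inter_subset_right).trans_lt measure_ball_lt_top).ne
  have hp : 0 < r ^ n * vB n := by positivity
  rw [← ENNReal.ofReal_toReal h1, ← ENNReal.ofReal_toReal (measure_ball_lt_top (x := x) (r := r)).ne,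
    ← measureReal_def, ← measureReal_def, vol_inter hm x hr, vol_ball x hr,
    ← ENNReal.ofReal_div_of_pos hp, sub_div, div_self hp.ne']

lemma freq_of_not_density {Ω : Set 𝔼} (hm : MeasurableSet Ω) {x : 𝔼}
    (hx : x ∉ densityPts Ω 1) :
    ∃ j : ℕ, ∃ᶠ r in 𝓝[>] (0:ℝ), (1 / ((j : ℝ) + 1)) * (r ^ n * vB n) ≤ cv Ω x r := by
  by_contra hcon
  push Not at hcon
  apply hx
  have hv := vB_pos (n := n)
  have ht : Tendsto (fun r => cv Ω x r / (r ^ n * vB n)) (𝓝[>] 0) (𝓝 0) := by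
    rw [Metric.tendsto_nhds]
    intro e he
    obtain ⟨j, hj⟩ := exists_nat_one_div_lt he
    filter_upwards [hcon j, self_mem_nhdsWithin] with r hr hr0
    have hr0 : 0 < r := hr0
    rw [Real.dist_eq, sub_zero, abs_of_nonneg (div_nonneg (cv_nonneg _ _ _) (by positivity)),
      div_lt_iff₀ (by positivity)]
    exact hr.trans (mul_lt_mul_of_pos_right hj (by positivity))
  have h2 : Tendsto (fun r => ENNReal.ofReal (1 - cv Ω x r / (r ^ n * vB n))) (𝓝[>] 0)
      (𝓝 (ENNReal.ofReal (1 - 0))) :=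
    (ENNReal.continuous_ofReal.tendsto _).comp (tendsto_const_nhds.sub ht)
  rw [sub_zero, ENNReal.ofReal_one] at h2
  refine h2.congr' ?_
  filter_upwards [self_mem_nhdsWithin] with r hr0
  exact (ratio_eq hm x hr0).symm

lemma mem_closure_of_density {Ω : Set 𝔼} {x : 𝔼} (hx : x ∈ densityPts Ω 1) : x ∈ closure Ω := by
  by_contra hcon
  have h1 : Ωᶜ ∈ 𝓝 x := by
    have : (closure Ω)ᶜ ∈ 𝓝 x := isClosed_closure.isOpen_compl.mem_nhds hcon
    exact mem_of_superset this (compl_subset_compl.2 subset_closure)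
  obtain ⟨s, hs, hsV⟩ := Metric.mem_nhds_iff.1 h1
  have h2 : Tendsto (fun r : ℝ => volume (Ω ∩ ball x r) / volume (ball x r)) (𝓝[>] 0) (𝓝 0) := by
    refine tendsto_const_nhds.congr' ?_
    have h2 : ∀ᶠ r in 𝓝[>] (0:ℝ), r ∈ Ioo 0 s := Ioo_mem_nhdsGT hs
    filter_upwards [h2] with r hr
    have : Ω ∩ ball x r = ∅ := by
      ext y; simp only [mem_inter_iff, mem_empty_iff_false, iff_false, not_and]
      intro hy hy2
      exact hsV (ball_subset_ball hr.2.le hy2) hy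
    simp [this]
  have := tendsto_nhds_unique hx h2
  simp at this

/-- dyadic choice of a scale -/
lemma exists_scale {Ω : Set 𝔼} {x : 𝔼} {c s : ℝ} (hs : 0 < s)
    (hsmall : ∀ r, s / 2 < r → r ≤ s → cv Ω x r ≤ c * (r ^ n * vB n))
    (hfreq : ∃ r, 0 < r ∧ r ≤ s ∧ c * (r ^ n * vB n) < cv Ω x r) :
    ∃ r, 0 < r ∧ r ≤ s ∧ c / 2 ^ n * (r ^ n * vB n) ≤ cv Ω x r ∧ cv Ω x r ≤ c * (r ^ n * vB n) := by
  classical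
  obtain ⟨r1, hr1, hr1s, hr1c⟩ := hfreq
  obtain ⟨N, hN1, hN2⟩ : ∃ N : ℕ, s / 2 < 2 ^ N * r1 ∧ 2 ^ N * r1 ≤ s := by
    obtain ⟨N, hN, hN'⟩ := exists_nat_pow_near (x := s / r1) (y := 2)
      (by rw [le_div_iff₀ hr1]; linarith) (by norm_num)
    refine ⟨N, ?_, ?_⟩
    · rw [div_lt_iff₀ hr1, pow_succ] at hN'
      linarith
    · rwa [le_div_iff₀ hr1] at hN
  have hex : ∃ N : ℕ, cv Ω x (2 ^ N * r1) ≤ c * ((2 ^ N * r1) ^ n * vB n) :=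
    ⟨N, hsmall _ hN1 hN2⟩
  set m := Nat.find hex with hmdef
  have hm1 : cv Ω x (2 ^ m * r1) ≤ c * ((2 ^ m * r1) ^ n * vB n) := Nat.find_spec hex
  have hmN : m ≤ N := Nat.find_min' hex (hsmall _ hN1 hN2)
  have hm0 : m ≠ 0 := by
    intro h
    rw [h] at hm1
    simp only [pow_zero, one_mul] at hm1
    linarith
  obtain ⟨k, hk⟩ := Nat.exists_eq_succ_of_ne_zero hm0
  have hk2 : ¬ (cv Ω x (2 ^ k * r1) ≤ c * ((2 ^ k * r1) ^ n * vB n)) :=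
    Nat.find_min hex (m := k) (by omega)
  rw [not_le] at hk2
  have hmle : (2:ℝ) ^ m ≤ 2 ^ N := pow_le_pow_right₀ (by norm_num) hmN
  refine ⟨2 ^ m * r1, by positivity, ?_, ?_, hm1⟩
  · exact (mul_le_mul_of_nonneg_right hmle hr1.le).trans hN2
  · have e : (2:ℝ) ^ m * r1 = 2 * (2 ^ k * r1) := by rw [hk, pow_succ]; ring
    have h3 : cv Ω x (2 ^ k * r1) ≤ cv Ω x (2 ^ m * r1) := by
      refine cv_mono Ω (ball_subset_ball ?_)
      rw [e]; have : 0 < 2 ^ k * r1 := by positivity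
      linarith
    refine le_trans (le_of_eq ?_) (hk2.le.trans h3)
    rw [e, mul_pow 2]; field_simp

lemma exists_cover (hn : 2 ≤ n) {Ω : Set 𝔼} (hm : MeasurableSet Ω) (hb : Bornology.IsBounded Ω)
    (hper : perimeter Ω ≠ ⊤) (hnull : μH[(n : ℝ) - 1] (frontier Ω ∩ densityPts Ω 1) = 0)
    {η : ℝ} (hη : 0 < η) :
    ∃ δ : ℝ, 0 < δ ∧ δ < 1 / 2 ∧ ∀ᶠ ε in 𝓝[>] (0:ℝ),
      Cov (ENNReal.ofReal η) ({x | 1 - 2 * δ ≤ um Ω ε x} \ interior Ω) := by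
  have hv := vB_pos (n := n)
  set P := rP Ω univ with hP
  have hP0 : 0 ≤ P := rP_nonneg _ _
  set c : ℝ := 1 / (5 * 6 ^ n) with hc
  have hc0 : 0 < c := by positivity
  have h6 : (1:ℝ) ≤ 6 ^ n := one_le_pow₀ (by norm_num)
  have hc1 : c * 6 ^ n < 1 / 4 := by
    rw [hc]; field_simp; norm_num
  have hc2 : c ≤ 1 / 2 := by
    rw [hc]
    apply one_div_le_one_div_of_le (by norm_num); linarith
  -- the null part
  let N1 : ℕ → Set 𝔼 := fun k => ⋃ j : ℕ, {x | x ∈ Ac Ω c (1 / ((k:ℝ) + 1)) ∧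
    ∃ᶠ r in 𝓝[>] (0:ℝ), (1 / ((j : ℝ) + 1)) * (r ^ n * vB n) ≤ cv Ω x r}
  have hN1 : NullC (⋃ k, N1 k) := NullC.iUnion fun k => NullC.iUnion fun j =>
    Ac_freq_null hn hm hb hper hc1 hc2 (by positivity) (by positivity)
  have hZ := null_of_hausdorff hn hnull
  -- constants
  set C := 2 * 3 ^ (n + 1) / (vB n) / (c / 2 ^ n) with hC
  have hC0 : 0 < C := by positivity
  set M := 21 ^ (n - 1) * C with hM
  have hM0 : 0 < M := by positivity
  set κ := η / (2 * M) with hκ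
  have hκ0 : 0 < κ := by positivity
  set D := min (c / 2) (κ / (4 * (P + 1))) with hD
  have hD0 : 0 < D := by positivity
  have hDc : D ≤ c / 2 := min_le_left _ _
  have hDκ : 2 * D * P ≤ κ / 2 := by
    have : D ≤ κ / (4 * (P + 1)) := min_le_right _ _
    rw [le_div_iff₀ (by positivity)] at this
    nlinarith
  set δ := D / (3 * 32 ^ n) with hδ
  have h32 : (1:ℝ) ≤ 32 ^ n := one_le_pow₀ (by norm_num)
  have hδ0 : 0 < δ := by positivity
  have hδD : δ * (3 * 32 ^ n) = D := by rw [hδ]; field_simp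
  have hδD2 : δ ≤ D := by nlinarith
  refine ⟨δ, hδ0, by linarith, ?_⟩
  have hev1 : ∀ᶠ e in 𝓝[>] (0:ℝ), rP Ω (Wb Ω e (1 - D) ∩ univ) ≤ 2 * D * P + κ / 2 :=
    lemA' hm hb hper hD0 (by linarith) isOpen_univ (by linarith)
  have htend : Tendsto (fun ε : ℝ => ε / 16) (𝓝[>] 0) (𝓝[>] 0) := by
    refine tendsto_nhdsWithin_iff.2 ⟨?_, ?_⟩
    · have : Tendsto (fun ε : ℝ => ε / 16) (𝓝 0) (𝓝 (0 / 16)) := tendsto_id.div_const 16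
      rw [zero_div] at this
      exact this.mono_left nhdsWithin_le_nhds
    · filter_upwards [self_mem_nhdsWithin] with ε hε
      have : 0 < ε := hε
      exact div_pos this (by norm_num)
  have hev2 : ∀ᶠ ε in 𝓝[>] (0:ℝ), ε ∈ Ioo 0 (1/2) := Ioo_mem_nhdsGT (by norm_num)
  filter_upwards [htend.eventually hev1, hev2] with ε h1 hε
  obtain ⟨hε0, hε1⟩ := hε
  set e := ε / 16 with he
  have he0 : 0 < e := by positivity
  rw [inter_univ] at h1
  let N3 : Set 𝔼 := {x | 1 - 2 * δ ≤ um Ω ε x ∧ ∀ k : ℕ, x ∉ Ac Ω c (1 / ((k:ℝ) + 1))}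
  have hN3 : Cov (ENNReal.ofReal (M * rP Ω (Wb Ω e (1 - D)))) N3 := by
    refine vitali_cov hper hC0.le ?_
    rintro x ⟨hx1, hx2⟩
    have hbig : cv Ω x (ε / 2) ≤ 2 * δ * (ε ^ n * vB n) :=
      (cv_le_one_sub_um hm hε0 x).trans
        (mul_le_mul_of_nonneg_right (by linarith) (by positivity))
    obtain ⟨r, hr0, hrs, hra, hrb⟩ := exists_scale (Ω := Ω) (x := x) (c := c) he0 (by
      intro r hr1 hr2
      have hr0 : 0 < r := by linarith
      have : ε ^ n ≤ 32 ^ n * r ^ n := by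
        rw [← mul_pow]; exact pow_le_pow_left₀ hε0.le (by rw [he] at hr1; linarith) n
      calc cv Ω x r ≤ cv Ω x (ε / 2) := cv_mono Ω (ball_subset_ball (by rw [he] at hr2; linarith))
        _ ≤ 2 * δ * (ε ^ n * vB n) := hbig
        _ ≤ 2 * δ * (32 ^ n * r ^ n * vB n) := by gcongr
        _ = (2 * δ * 32 ^ n) * (r ^ n * vB n) := by ring
        _ ≤ c * (r ^ n * vB n) := by
          apply mul_le_mul_of_nonneg_right _ (by positivity)
          linarith) (by
      obtain ⟨k, hk⟩ := exists_nat_one_div_lt he0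
      have := hx2 k
      simp only [Ac, mem_ofPred_eq] at this
      push Not at this
      obtain ⟨r, hr0, hr1, hr2⟩ := this
      exact ⟨r, hr0, by linarith, hr2⟩)
    refine ⟨r, hr0, by rw [he] at hrs; linarith, ?_, ?_⟩
    · intro y hy
      refine mem_Wb he0 fun z hz => lt_um hm he0 ?_
      have hy : dist y x < 5 * r := hy
      have h3 : cv Ω z e ≤ cv Ω x (ε / 2) := by
        refine cv_mono Ω (ball_subset_ball' ?_)
        have := dist_triangle z y x
        rw [he] at *
        linarith
      have e2 : ε ^ n = 32 ^ n * (e / 2) ^ n := by rw [← mul_pow, he]; ring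
      have h5 : 0 < (e / 2) ^ n * vB n := by positivity
      calc cv Ω z e ≤ 2 * δ * (ε ^ n * vB n) := h3.trans hbig
        _ = (2 * δ * 32 ^ n) * ((e / 2) ^ n * vB n) := by rw [e2]; ring
        _ < D * ((e / 2) ^ n * vB n) := by
          apply mul_lt_mul_of_pos_right _ h5
          nlinarith
    · refine iso' hn hm hb hper hr0 (by positivity) hra (hrb.trans ?_)
      exact mul_le_mul_of_nonneg_right hc2 (by positivity)
  have hη4 : 0 < ENNReal.ofReal (η / 4) := ENNReal.ofReal_pos.2 (by linarith)
  refine (((hZ _ hη4).union (hN1 _ hη4)).union hN3).mono ?_ ?_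
  · rw [← ENNReal.ofReal_add (by linarith) (by linarith), ← ENNReal.ofReal_add (by linarith)
      (mul_nonneg hM0.le (rP_nonneg _ _))]
    apply ENNReal.ofReal_le_ofReal
    have h7 : M * rP Ω (Wb Ω e (1 - D)) ≤ M * κ :=
      mul_le_mul_of_nonneg_left (by linarith) hM0.le
    have h8 : M * κ = η / 2 := by rw [hκ]; field_simp
    linarith
  · rintro x ⟨hx1, hx2⟩
    by_cases hd : x ∈ densityPts Ω 1
    · exact Or.inl (Or.inl ⟨⟨mem_closure_of_density hd, hx2⟩, hd⟩)
    · by_cases hA : ∃ k : ℕ, x ∈ Ac Ω c (1 / ((k:ℝ) + 1))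
      · obtain ⟨k, hk⟩ := hA
        obtain ⟨j, hj⟩ := freq_of_not_density hm hd
        exact Or.inl (Or.inr (mem_iUnion.2 ⟨k, mem_iUnion.2 ⟨j, hk, hj⟩⟩))
      · push Not at hA
        exact Or.inr ⟨hx1, hA⟩

end Bad

/-! ### Construction of a smooth function compactly supported in the interior -/

section BuildW
variable {n : ℕ}

local notation "𝔼" => EuclideanSpace ℝ (Fin n)

lemma exists_bump (hn : 2 ≤ n) : ∃ C : ℝ, 0 < C ∧ ∀ (x : 𝔼) (R : ℝ), 0 < R → R ≤ 1 →
    ∃ ζ : 𝔼 → ℝ, ContDiff ℝ (⊤ : ℕ∞) ζ ∧ HasCompactSupport ζ ∧ (∀ y, 0 ≤ ζ y) ∧ (∀ y, ζ y ≤ 1) ∧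
      (∀ y ∈ ball x R, ζ y = 1) ∧ ∫ y, ζ y ≤ C * R ^ (n - 1) ∧
      ∫ y, ‖fderiv ℝ ζ y‖ ≤ C * R ^ (n - 1) := by
  let b : ContDiffBump (0 : 𝔼) := ⟨1, 2, by norm_num, by norm_num⟩
  have hbc : ContDiff ℝ (⊤ : ℕ∞) b := b.contDiff
  set I1 := ∫ y, b y with hI1
  set I2 := ∫ y, ‖fderiv ℝ b y‖ with hI2
  have hI1p : 0 ≤ I1 := integral_nonneg fun y => b.nonneg
  have hI2p : 0 ≤ I2 := integral_nonneg fun y => norm_nonneg _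
  refine ⟨I1 + I2 + 1, by linarith, fun x R hR hR1 => ?_⟩
  have e2 : R ^ n = R ^ (n - 1) * R := by rw [← pow_succ]; congr 1; omega
  have hchange : ∀ f : 𝔼 → ℝ, ∫ y, f (R⁻¹ • (y - x)) = R ^ n * ∫ y, f y := by
    intro f
    rw [integral_sub_right_eq_self (fun y => f (R⁻¹ • y)) x, Measure.integral_comp_inv_smul]
    simp [abs_of_pos hR]
  have hfd : ∀ y, fderiv ℝ (fun y => b (R⁻¹ • (y - x))) y = R⁻¹ • fderiv ℝ b (R⁻¹ • (y - x)) := by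
    intro y
    have h1 : HasFDerivAt (fun y : 𝔼 => R⁻¹ • (y - x)) (R⁻¹ • ContinuousLinearMap.id ℝ 𝔼) y :=
      ((hasFDerivAt_id y).sub_const x).const_smul R⁻¹
    have h2 := ((hbc.differentiable (by simp)) (R⁻¹ • (y - x))).hasFDerivAt.comp y h1
    have h3 : HasFDerivAt (fun y => b (R⁻¹ • (y - x))) _ y := h2
    rw [h3.fderiv]
    ext v; simp
  refine ⟨fun y => b (R⁻¹ • (y - x)), ?_, ?_, fun y => b.nonneg, fun y => b.le_one, ?_, ?_, ?_⟩
  · exact hbc.comp (ContDiff.const_smul R⁻¹ (contDiff_id.sub contDiff_const))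
  · refine HasCompactSupport.intro (isCompact_closedBall x (2 * R)) fun y hy => ?_
    have hy : 2 * R < dist y x := by simpa using hy
    apply b.zero_of_le_dist
    rw [dist_zero_right, norm_smul, ← dist_eq_norm, norm_inv, Real.norm_of_nonneg hR.le]
    show 2 ≤ _
    rw [inv_mul_eq_div, le_div_iff₀ hR]
    exact hy.le
  · intro y hy
    have hy : dist y x < R := hy
    apply b.one_of_mem_closedBall
    rw [mem_closedBall, dist_zero_right, norm_smul, ← dist_eq_norm, norm_inv,
      Real.norm_of_nonneg hR.le]
    show _ ≤ (1:ℝ)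
    rw [inv_mul_eq_div, div_le_iff₀ hR]
    linarith
  · rw [hchange (fun y => b y), ← hI1, e2]
    have : 0 < R ^ (n - 1) := by positivity
    calc R ^ (n - 1) * R * I1 = (R * I1) * R ^ (n - 1) := by ring
      _ ≤ (I1 + I2 + 1) * R ^ (n - 1) := by
        apply mul_le_mul_of_nonneg_right _ this.le
        nlinarith
  · simp_rw [hfd, norm_smul]
    rw [hchange (fun y => ‖R⁻¹‖ * ‖fderiv ℝ b y‖), integral_const_mul, ← hI2, e2, norm_inv,
      Real.norm_of_nonneg hR.le]
    have : 0 < R ^ (n - 1) := by positivity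
    calc R ^ (n - 1) * R * (R⁻¹ * I2) = I2 * R ^ (n - 1) := by field_simp
      _ ≤ (I1 + I2 + 1) * R ^ (n - 1) := by
        apply mul_le_mul_of_nonneg_right _ this.le
        linarith

/-- admissible functions -/
structure Adm (w : EuclideanSpace ℝ (Fin n) → ℝ) : Prop where
  cd : ContDiff ℝ (⊤ : ℕ∞) w
  cs : HasCompactSupport w
  nn : ∀ y, 0 ≤ w y
  le : ∀ y, w y ≤ 1

lemma Adm.int {w : 𝔼 → ℝ} (h : Adm w) : Integrable w :=
  h.cd.continuous.integrable_of_hasCompactSupport h.cs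

lemma int_fd {w : 𝔼 → ℝ} (h : ContDiff ℝ (⊤ : ℕ∞) w) (hc : HasCompactSupport w) :
    Integrable (fun y => ‖fderiv ℝ w y‖) :=
  ((h.continuous_fderiv (by simp)).norm).integrable_of_hasCompactSupport (hc.fderiv ℝ).norm

lemma cutout {C : ℝ} (hC : ∀ (x : 𝔼) (R : ℝ), 0 < R → R ≤ 1 →
    ∃ ζ : 𝔼 → ℝ, ContDiff ℝ (⊤ : ℕ∞) ζ ∧ HasCompactSupport ζ ∧ (∀ y, 0 ≤ ζ y) ∧ (∀ y, ζ y ≤ 1) ∧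
      (∀ y ∈ ball x R, ζ y = 1) ∧ ∫ y, ζ y ≤ C * R ^ (n - 1) ∧
      ∫ y, ‖fderiv ℝ ζ y‖ ≤ C * R ^ (n - 1)) {w : 𝔼 → ℝ} (hw : Adm w)
    (S : Finset (𝔼 × ℝ)) (hS : ∀ p ∈ S, 0 < p.2 ∧ p.2 ≤ 1) :
    ∃ w' : 𝔼 → ℝ, Adm w' ∧ (∀ y, w y = 0 → w' y = 0) ∧
      (∀ p ∈ S, ∀ y ∈ ball p.1 p.2, w' y = 0) ∧
      ∫ y, |w' y - w y| ≤ C * ∑ p ∈ S, p.2 ^ (n - 1) ∧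
      ∫ y, ‖fderiv ℝ w' y‖ ≤ (∫ y, ‖fderiv ℝ w y‖) + C * ∑ p ∈ S, p.2 ^ (n - 1) := by
  classical
  induction S using Finset.induction_on with
  | empty => exact ⟨w, hw, fun _ h => h, by simp, by simp, by simp⟩
  | insert p S hp ih =>
    obtain ⟨w₁, h1, h2, h3, h4, h5⟩ := ih fun q hq => hS q (Finset.mem_insert_of_mem hq)
    obtain ⟨hp0, hp1⟩ := hS p (Finset.mem_insert_self _ _)
    obtain ⟨ζ, z1, z2, z3, z4, z5, z6, z7⟩ := hC p.1 p.2 hp0 hp1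
    have hA : Adm (fun y => w₁ y * (1 - ζ y)) := by
      refine ⟨h1.cd.mul (contDiff_const.sub z1), h1.cs.mul_right, fun y => ?_, fun y => ?_⟩
      · exact mul_nonneg (h1.nn y) (by linarith [z4 y])
      · exact mul_le_one₀ (h1.le y) (by linarith [z4 y]) (by linarith [z3 y])
    have hζi : Integrable ζ := z1.continuous.integrable_of_hasCompactSupport z2
    refine ⟨fun y => w₁ y * (1 - ζ y), hA, fun y hy => by simp [h2 y hy], ?_, ?_, ?_⟩
    · intro q hq y hy
      rcases Finset.mem_insert.1 hq with rfl | hq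
      · simp [z5 y hy]
      · simp [h3 q hq y hy]
    · rw [Finset.sum_insert hp, mul_add]
      have hi : Integrable (fun y => |w₁ y - w y|) := (h1.int.sub hw.int).abs
      calc ∫ y, |w₁ y * (1 - ζ y) - w y| ≤ ∫ y, (ζ y + |w₁ y - w y|) := by
            refine integral_mono (hA.int.sub hw.int).abs (hζi.add hi) fun y => ?_
            have e : w₁ y * (1 - ζ y) - w y = -(w₁ y * ζ y) + (w₁ y - w y) := by ring
            have h6 : |-(w₁ y * ζ y)| ≤ ζ y := by
              rw [abs_neg, abs_of_nonneg (mul_nonneg (h1.nn y) (z3 y))]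
              exact mul_le_of_le_one_left (z3 y) (h1.le y)
            show |w₁ y * (1 - ζ y) - w y| ≤ ζ y + |w₁ y - w y|
            rw [e]
            exact (abs_add_le _ _).trans (by linarith)
        _ = (∫ y, ζ y) + ∫ y, |w₁ y - w y| := integral_add hζi hi
        _ ≤ _ := by linarith
    · rw [Finset.sum_insert hp, mul_add]
      have i1 := int_fd h1.cd h1.cs
      have i2 := int_fd z1 z2
      calc ∫ y, ‖fderiv ℝ (fun y => w₁ y * (1 - ζ y)) y‖
          ≤ ∫ y, (‖fderiv ℝ w₁ y‖ + ‖fderiv ℝ ζ y‖) := by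
            refine integral_mono (int_fd hA.cd hA.cs) (i1.add i2) fun y => ?_
            have d1 := ((h1.cd.differentiable (by simp)) y)
            have d2 := ((z1.differentiable (by simp)) y)
            have e : fderiv ℝ (fun y => w₁ y * (1 - ζ y)) y =
                w₁ y • (-fderiv ℝ ζ y) + (1 - ζ y) • fderiv ℝ w₁ y := by
              have := (d1.hasFDerivAt.mul (d2.hasFDerivAt.const_sub 1))
              exact this.fderiv
            show ‖fderiv ℝ (fun y => w₁ y * (1 - ζ y)) y‖ ≤ ‖fderiv ℝ w₁ y‖ + ‖fderiv ℝ ζ y‖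
            rw [e]
            refine (norm_add_le _ _).trans ?_
            rw [norm_smul, norm_smul, norm_neg, Real.norm_of_nonneg (h1.nn y),
              Real.norm_of_nonneg (by linarith [z4 y] : 0 ≤ 1 - ζ y)]
            have a1 := mul_le_of_le_one_left (norm_nonneg (fderiv ℝ ζ y)) (h1.le y)
            have a2 := mul_le_of_le_one_left (norm_nonneg (fderiv ℝ w₁ y))
              (by linarith [z3 y] : 1 - ζ y ≤ 1)
            linarith
        _ = (∫ y, ‖fderiv ℝ w₁ y‖) + ∫ y, ‖fderiv ℝ ζ y‖ := integral_add i1 i2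
        _ ≤ _ := by linarith

lemma exists_w (hn : 2 ≤ n) {Ω : Set 𝔼} (hm : MeasurableSet Ω) (hb : Bornology.IsBounded Ω)
    (hper : perimeter Ω ≠ ⊤) (hnull : μH[(n : ℝ) - 1] (frontier Ω ∩ densityPts Ω 1) = 0)
    {η : ℝ} (hη : 0 < η) :
    ∃ w : 𝔼 → ℝ, Adm w ∧ tsupport w ⊆ interior Ω ∧ ∫ y, |w y - ind Ω y| ≤ η ∧
      ∫ y, ‖fderiv ℝ w y‖ ≤ rP Ω univ + η := by
  obtain ⟨C, hC0, hC⟩ := exists_bump hn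
  obtain ⟨δ, hδ0, hδ1, hcov⟩ := exists_cover hn hm hb hper hnull (η := η / (2 * C)) (by positivity)
  obtain ⟨h, hh1, hh2, hh3, hh4, hh5⟩ := exists_h hm hb hper hδ0 hδ1
  have hh0 : h 0 = 0 := hh2 0 (by linarith)
  have hL1 := (um_L1 hm hb hh1.continuous).eventually_lt_const (u := η / 2) (by linarith)
  have hev2 : ∀ᶠ ε in 𝓝[>] (0:ℝ), 0 < ε := self_mem_nhdsWithin
  obtain ⟨ε, ⟨⟨hS, hfd⟩, hL⟩, hε⟩ := (((hcov.and (hh5 (η / 2) (by linarith))).and hL1).and hev2).exists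
  obtain ⟨S, hS1, hS2, hS3⟩ := hS
  have hucont := (um_contDiff hm hb ε (m := 1)).continuous
  have hclosed : IsClosed {x | 1 - 2 * δ ≤ um Ω ε x} := isClosed_le continuous_const hucont
  have hK : IsCompact ({x | 1 - 2 * δ ≤ um Ω ε x} \ interior Ω) := by
    refine (um_hcs hb ε).of_isClosed_subset (hclosed.sdiff isOpen_interior) ?_
    intro x hx
    apply subset_tsupport
    have h1 : 1 - 2 * δ ≤ um Ω ε x := hx.1
    have : um Ω ε x ≠ 0 := by intro h0; rw [h0] at h1; linarith
    exact this
  obtain ⟨T, hTS, hTf, hTc⟩ := hK.elim_finite_subcover_image (fun p _ => isOpen_ball) hS2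
  have hsum : ∑ p ∈ hTf.toFinset, p.2 ^ (n - 1) ≤ η / (2 * C) := by
    have e1 : ENNReal.ofReal (∑ p ∈ hTf.toFinset, p.2 ^ (n - 1)) ≤ ENNReal.ofReal (η / (2 * C)) := by
      rw [ENNReal.ofReal_sum_of_nonneg (fun p hp => pow_nonneg
        (hS1 p (hTS (hTf.mem_toFinset.1 hp))).1.le _)]
      refine le_trans ?_ hS3
      have h1 : ∑' p : T, ENNReal.ofReal (p.1.2 ^ (n - 1)) ≤
          ∑' p : S, ENNReal.ofReal (p.1.2 ^ (n - 1)) :=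
        ENNReal.tsum_mono_subtype (fun p : 𝔼 × ℝ => ENNReal.ofReal (p.2 ^ (n - 1))) hTS
      refine le_trans (le_of_eq ?_) h1
      have h2 := Finset.tsum_subtype hTf.toFinset
        (fun p : 𝔼 × ℝ => ENNReal.ofReal (p.2 ^ (n - 1)))
      rw [← h2]
      refine tsum_congr_set_coe (fun p : 𝔼 × ℝ => ENNReal.ofReal (p.2 ^ (n - 1))) ?_
      simp
    exact (ENNReal.ofReal_le_ofReal_iff (by positivity)).1 e1
  have hu01 : ∀ y, um Ω ε y ∈ Icc (0:ℝ) 1 := fun y => ⟨um_nonneg _ _ _, um_le _ _ _⟩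
  have hw : Adm (fun y => h (um Ω ε y)) :=
    ⟨hh1.comp (um_contDiff hm hb ε), (um_hcs hb ε).comp_left hh0,
      fun y => (hh4 _ (hu01 y)).1, fun y => (hh4 _ (hu01 y)).2⟩
  obtain ⟨w, w1, w2, w3, w4, w5⟩ := cutout hC hw hTf.toFinset
    (fun p hp => hS1 p (hTS (hTf.mem_toFinset.1 hp)))
  have hCs : C * ∑ p ∈ hTf.toFinset, p.2 ^ (n - 1) ≤ η / 2 := by
    calc _ ≤ C * (η / (2 * C)) := mul_le_mul_of_nonneg_left hsum hC0.le
      _ = η / 2 := by field_simp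
  refine ⟨w, w1, ?_, ?_, by linarith⟩
  · have hcl : IsClosed ({x | 1 - 2 * δ ≤ um Ω ε x} \ ⋃ p ∈ T, ball p.1 p.2) :=
      hclosed.sdiff (isOpen_biUnion fun p _ => isOpen_ball)
    have hsub : tsupport w ⊆ {x | 1 - 2 * δ ≤ um Ω ε x} \ ⋃ p ∈ T, ball p.1 p.2 := by
      refine closure_minimal ?_ hcl
      intro y hy
      have hy : w y ≠ 0 := hy
      constructor
      · show 1 - 2 * δ ≤ um Ω ε y
        by_contra hcon
        rw [not_le] at hcon
        exact hy (w2 y (hh2 _ hcon.le))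
      · intro hmem
        obtain ⟨p, hp, hyp⟩ := mem_iUnion₂.1 hmem
        exact hy (w3 p (hTf.mem_toFinset.2 hp) y hyp)
    intro y hy
    obtain ⟨h1, h2⟩ := hsub hy
    by_contra hcon
    exact h2 (hTc ⟨h1, hcon⟩)
  · have hind : ∀ y, h (ind Ω y) = ind Ω y := by
      intro y
      by_cases hy : y ∈ Ω
      · simp [ind, hy, hh3]
      · simp [ind, hy, hh0]
    simp_rw [hind] at hL
    have hii := ind_integrable hm hb
    calc ∫ y, |w y - ind Ω y| ≤ ∫ y, (|w y - h (um Ω ε y)| + |h (um Ω ε y) - ind Ω y|) :=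
          integral_mono (w1.int.sub hii).abs ((w1.int.sub hw.int).abs.add (hw.int.sub hii).abs)
            fun y => abs_sub_le _ _ _
      _ = (∫ y, |w y - h (um Ω ε y)|) + ∫ y, |h (um Ω ε y) - ind Ω y| :=
          integral_add (w1.int.sub hw.int).abs (hw.int.sub hii).abs
      _ ≤ _ := by linarith

end BuildW

/-! ### Coarea: choosing good level sets -/

section Coarea
variable {n : ℕ}

local notation "𝔼" => EuclideanSpace ℝ (Fin n)

/-- shorthand for the smooth step and its derivative -/
def stepD (s : ℝ) : ℝ := deriv Real.smoothTransition s

lemma stepD_hasDeriv (s : ℝ) : HasDerivAt Real.smoothTransition (stepD s) s :=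
  ((Real.smoothTransition.contDiff (n := 1)).differentiable (by simp) s).hasDerivAt

lemma stepD_nonneg (s : ℝ) : 0 ≤ stepD s := Real.smoothTransition.monotone.deriv_nonneg

lemma stepD_cont : Continuous stepD :=
  (Real.smoothTransition.contDiff (n := 1)).continuous_deriv (by simp)

lemma level_le {F : 𝔼 → ℝ} (hF : ContDiff ℝ (⊤ : ℕ∞) F) (t : ℝ) :
    perimeter {x | t < F x} ≤ liminf (fun k : ℕ =>
      ∫⁻ x, ENNReal.ofReal (k * stepD (k * (F x - t)) * ‖fderiv ℝ F x‖)) atTop := by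
  refine relP_le fun φ hφ => ?_
  have hmeas : MeasurableSet {x | t < F x} := (isOpen_lt continuous_const hF.continuous).measurableSet
  have hlim : Tendsto (fun k : ℕ => ∫ x, Real.smoothTransition (k * (F x - t)) * vdiv φ x) atTop
      (𝓝 (∫ x in {x | t < F x}, vdiv φ x)) := by
    rw [← integral_indicator hmeas]
    refine tendsto_integral_of_dominated_convergence (fun x => ‖vdiv φ x‖) ?_
      (vdiv_integrable hφ.cd hφ.cs).norm ?_ ?_
    · intro k
      refine Continuous.aestronglyMeasurable ?_
      exact (Real.smoothTransition.continuous.comp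
        (continuous_const.mul (hF.continuous.sub continuous_const))).mul (vdiv_continuous hφ.cd)
    · intro k
      refine ae_of_all _ fun x => ?_
      rw [norm_mul, Real.norm_of_nonneg (Real.smoothTransition.nonneg _)]
      exact mul_le_of_le_one_left (norm_nonneg _) (Real.smoothTransition.le_one _)
    · refine ae_of_all _ fun x => ?_
      by_cases h : t < F x
      · rw [indicator_of_mem (by exact h)]
        refine tendsto_const_nhds.congr' ?_
        obtain ⟨N, hN⟩ := exists_nat_ge (1 / (F x - t))
        filter_upwards [eventually_ge_atTop N] with k hk
        rw [Real.smoothTransition.one_of_one_le, one_mul]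
        have h0 : 0 < F x - t := by linarith
        rw [← div_le_iff₀ h0]
        exact hN.trans (by exact_mod_cast hk)
      · rw [indicator_of_notMem (by exact h)]
        refine tendsto_const_nhds.congr fun k => ?_
        rw [Real.smoothTransition.zero_of_nonpos, zero_mul]
        exact mul_nonpos_of_nonneg_of_nonpos (by positivity) (by linarith)
  have hlim2 := (ENNReal.continuous_ofReal.tendsto _).comp hlim
  rw [← hlim2.liminf_eq]
  refine liminf_le_liminf (Eventually.of_forall fun k => ?_)
  simp only [Function.comp_apply]
  have hu : ContDiff ℝ 1 (fun x => Real.smoothTransition (k * (F x - t))) :=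
    (Real.smoothTransition.contDiff (n := 1)).comp
      (contDiff_const.mul ((hF.of_le (by norm_cast)).sub contDiff_const))
  rw [ibp hu hφ.cd hφ.cs]
  refine (Real.ofReal_le_enorm _).trans ?_
  rw [enorm_neg]
  refine (enorm_integral_le_lintegral_enorm _).trans (lintegral_mono fun x => ?_)
  have h2 : HasFDerivAt (fun x => Real.smoothTransition (k * (F x - t)))
      (stepD (k * (F x - t)) • ((k : ℝ) • fderiv ℝ F x)) x :=
    (stepD_hasDeriv _).comp_hasFDerivAt x
      (((hF.differentiable (by simp) x).hasFDerivAt.sub_const t).const_mul (k : ℝ))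
  rw [h2.fderiv, ← ofReal_norm]
  refine ENNReal.ofReal_le_ofReal ?_
  simp only [smul_apply, norm_smul]
  rw [Real.norm_of_nonneg (stepD_nonneg _), Real.norm_of_nonneg (by positivity : (0:ℝ) ≤ k)]
  have h3 : ‖fderiv ℝ F x (φ x)‖ ≤ ‖fderiv ℝ F x‖ :=
    ((fderiv ℝ F x).le_opNorm _).trans (mul_le_of_le_one_right (norm_nonneg _) (hφ.le x))
  have := stepD_nonneg (k * (F x - t))
  calc stepD (k * (F x - t)) * (k * ‖fderiv ℝ F x (φ x)‖)
      ≤ stepD (k * (F x - t)) * (k * ‖fderiv ℝ F x‖) := by gcongr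
    _ = _ := by ring

lemma inner_le (k : ℕ) {a b : ℝ} (hab : a ≤ b) (s : ℝ) :
    ∫⁻ t in Ioc a b, ENNReal.ofReal (k * stepD (k * (s - t))) ≤ 1 := by
  have hc : Continuous fun t : ℝ => k * stepD (k * (s - t)) :=
    continuous_const.mul (stepD_cont.comp (continuous_const.mul (continuous_const.sub continuous_id)))
  rw [← ofReal_integral_eq_lintegral_ofReal, ← intervalIntegral.integral_of_le hab]
  · have hd : ∀ t ∈ uIcc a b, HasDerivAt (fun t => - Real.smoothTransition (k * (s - t)))
        (k * stepD (k * (s - t))) t := by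
      intro t _
      have h1 : HasDerivAt (fun t : ℝ => (k:ℝ) * (s - t)) (k * (-1)) t :=
        ((hasDerivAt_id t).const_sub s).const_mul (k:ℝ)
      have h2 := ((stepD_hasDeriv (k * (s - t))).comp t h1).neg
      have e : (k:ℝ) * stepD (k * (s - t)) = -(stepD (k * (s - t)) * (k * (-1))) := by ring
      rw [e]
      exact h2
    rw [intervalIntegral.integral_eq_sub_of_hasDerivAt hd (hc.intervalIntegrable _ _)]
    rw [ENNReal.ofReal_le_one]
    have := Real.smoothTransition.nonneg (k * (s - b))
    have := Real.smoothTransition.le_one (k * (s - a))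
    linarith
  · exact (hc.integrableOn_Icc).mono_set Ioc_subset_Icc_self
  · exact ae_of_all _ fun t => mul_nonneg (by positivity) (stepD_nonneg _)

lemma exists_level {F : 𝔼 → ℝ} (hF : ContDiff ℝ (⊤ : ℕ∞) F) (hc : HasCompactSupport F)
    {a b : ℝ} (hab : a < b) {N : Set ℝ} (hN : volume N = 0) :
    ∃ t ∈ Ioc a b, t ∉ N ∧
      perimeter {x | t < F x} ≤ ENNReal.ofReal ((∫ x, ‖fderiv ℝ F x‖) / (b - a)) := by
  let Φ : ℕ → ℝ → ℝ≥0∞ := fun k t =>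
    ∫⁻ x, ENNReal.ofReal (k * stepD (k * (F x - t)) * ‖fderiv ℝ F x‖)
  have hcont : ∀ k : ℕ, Continuous fun p : ℝ × 𝔼 =>
      ENNReal.ofReal (k * stepD (k * (F p.2 - p.1)) * ‖fderiv ℝ F p.2‖) := by
    intro k
    refine ENNReal.continuous_ofReal.comp ?_
    exact (continuous_const.mul (stepD_cont.comp (continuous_const.mul
      ((hF.continuous.comp continuous_snd).sub continuous_fst)))).mul
      ((hF.continuous_fderiv (by simp)).comp continuous_snd).norm
  have hΦm : ∀ k, Measurable (Φ k) := fun k => (hcont k).measurable.lintegral_prod_right'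
  have hΦ : ∀ k, ∫⁻ t in Ioc a b, Φ k t ≤ ENNReal.ofReal (∫ x, ‖fderiv ℝ F x‖) := by
    intro k
    simp only [Φ]
    rw [lintegral_lintegral_swap (hcont k).measurable.aemeasurable,
      ofReal_integral_eq_lintegral_ofReal (int_fd hF hc) (ae_of_all _ fun x => norm_nonneg _)]
    refine lintegral_mono fun x => ?_
    have h1 : ∀ t : ℝ, ENNReal.ofReal (k * stepD (k * (F x - t)) * ‖fderiv ℝ F x‖)
        = ENNReal.ofReal (k * stepD (k * (F x - t))) * ENNReal.ofReal ‖fderiv ℝ F x‖ := fun t =>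
      ENNReal.ofReal_mul (mul_nonneg (by positivity) (stepD_nonneg _))
    simp_rw [h1]
    rw [lintegral_mul_const' _ _ ENNReal.ofReal_ne_top]
    exact (mul_le_mul_left (inner_le k hab.le (F x)) _).trans (one_mul _).le
  have hL : ∫⁻ t in Ioc a b, liminf (fun k => Φ k t) atTop ≤ ENNReal.ofReal (∫ x, ‖fderiv ℝ F x‖) := by
    refine (lintegral_liminf_le hΦm).trans ?_
    refine liminf_le_of_le (by isBoundedDefault) fun c hc => ?_
    obtain ⟨k, hk⟩ := hc.exists
    exact hk.trans (hΦ k)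
  have hne : volume.restrict (Ioc a b) ≠ 0 := by
    rw [Ne, Measure.restrict_eq_zero, Real.volume_Ioc]
    simp [hab]
  have hN2 : volume.restrict (Ioc a b) (N ∪ (Ioc a b)ᶜ) = 0 := by
    rw [measure_union_null_iff]
    refine ⟨Measure.restrict_le_self.absolutelyContinuous hN, ?_⟩
    rw [Measure.restrict_apply measurableSet_Ioc.compl]; simp
  obtain ⟨t, ht, hle⟩ := exists_notMem_null_le_laverage hne
    (Measurable.liminf hΦm).aemeasurable hN2
  simp only [mem_union, mem_compl_iff, not_or, not_not] at ht
  refine ⟨t, ht.2, ht.1, (level_le hF t).trans (hle.trans ?_)⟩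
  rw [setLAverage_eq, Real.volume_Ioc, ENNReal.ofReal_div_of_pos (by linarith)]
  exact ENNReal.div_le_div_right hL _

end Coarea

/-! ### Generic perturbation and smooth level sets -/

section Perturb
variable {n : ℕ}

local notation "𝔼" => EuclideanSpace ℝ (Fin n)

lemma exists_generic {w : 𝔼 → ℝ} (hw : ContDiff ℝ (⊤ : ℕ∞) w) {ε : ℝ} (hε : 0 < ε) :
    ∃ a : 𝔼, ‖a‖ < ε ∧ {x | fderiv ℝ w x = InnerProductSpace.toDual ℝ 𝔼 a}.Countable := by
  let G : 𝔼 → 𝔼 := fun x => (InnerProductSpace.toDual ℝ 𝔼).symm (fderiv ℝ w x)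
  have hGc : ContDiff ℝ 1 G := by
    have h1 : ContDiff ℝ 1 (fderiv ℝ w) := hw.fderiv_right (m := 1) (by norm_cast)
    exact ((InnerProductSpace.toDual ℝ 𝔼).symm.toContinuousLinearEquiv.contDiff).comp h1
  have hGd : ∀ x, HasFDerivAt G (fderiv ℝ G x) x := fun x =>
    (hGc.differentiable one_ne_zero x).hasFDerivAt
  have hnull : volume (G '' {x | (fderiv ℝ G x).det = 0}) = 0 :=
    addHaar_image_eq_zero_of_det_fderivWithin_eq_zero volume
      (fun x _ => (hGd x).hasFDerivWithinAt) (fun x hx => hx)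
  have hex : ∃ a ∈ ball (0:𝔼) ε, a ∉ G '' {x | (fderiv ℝ G x).det = 0} := by
    by_contra! h
    have : volume (ball (0:𝔼) ε) ≤ 0 := (measure_mono h).trans hnull.le
    exact absurd this (not_le.2 (measure_ball_pos _ _ hε))
  obtain ⟨a, ha, hreg⟩ := hex
  refine ⟨a, by simpa using ha, ?_⟩
  have hset : {x | fderiv ℝ w x = InnerProductSpace.toDual ℝ 𝔼 a} = {x | G x = a} := by
    ext x
    simp only [mem_ofPred_eq, G]
    rw [LinearIsometryEquiv.symm_apply_eq]
  rw [hset]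
  refine (HereditarilyLindelofSpace.isLindelof {x | G x = a}).countable_of_isDiscrete ?_
  rw [isDiscrete_iff_nhdsNE]
  intro x hx
  have hdet : (fderiv ℝ G x).det ≠ 0 := fun h => hreg ⟨x, h, hx⟩
  have hanti : ∃ C, AntilipschitzWith C (fderiv ℝ G x) :=
    ⟨_, ((fderiv ℝ G x).toContinuousLinearEquivOfDetNeZero hdet).antilipschitz⟩
  have h := (hGd x).eventually_ne (c := a) hanti
  rw [inf_principal_eq_bot]
  exact h

lemma exists_perturb {w : 𝔼 → ℝ} (hw : ContDiff ℝ (⊤ : ℕ∞) w) (hwc : HasCompactSupport w)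
    {R ε : ℝ} (hR : 0 < R) (hε : 0 < ε) :
    ∃ F : 𝔼 → ℝ, ContDiff ℝ (⊤ : ℕ∞) F ∧ HasCompactSupport F ∧ (∀ x, |F x - w x| ≤ ε) ∧
      ∫ x, ‖fderiv ℝ F x‖ ≤ (∫ x, ‖fderiv ℝ w x‖) + ε ∧
      {x ∈ ball (0:𝔼) R | fderiv ℝ F x = 0}.Countable := by
  let χ : ContDiffBump (0:𝔼) := ⟨R, R + 1, hR, by linarith⟩
  let v : 𝔼 → 𝔼 := fun x => χ x • x
  have hv : ContDiff ℝ (⊤ : ℕ∞) v := χ.contDiff.smul contDiff_id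
  have hvc : HasCompactSupport v := χ.hasCompactSupport.smul_right
  obtain ⟨M, hM⟩ := hv.continuous.bounded_above_of_compact_support hvc
  have hM0 : 0 ≤ M := (norm_nonneg _).trans (hM 0)
  have hfv : Integrable (fun x => ‖fderiv ℝ v x‖) :=
    ((hv.continuous_fderiv (by simp)).norm).integrable_of_hasCompactSupport (hvc.fderiv ℝ).norm
  set K := ∫ x, ‖fderiv ℝ v x‖ with hK
  have hK0 : 0 ≤ K := integral_nonneg fun x => norm_nonneg _
  obtain ⟨a, ha, hcount⟩ := exists_generic hw (ε := ε / (M + K + 1)) (by positivity)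
  set L := InnerProductSpace.toDual ℝ 𝔼 a with hL
  have hLn : ‖L‖ = ‖a‖ := LinearIsometryEquiv.norm_map _ _
  have haε : ‖a‖ * (M + K + 1) ≤ ε := by
    rw [lt_div_iff₀ (by positivity)] at ha; exact ha.le
  have ha0 := norm_nonneg a
  have hp : ContDiff ℝ (⊤ : ℕ∞) (fun x => L (v x)) := L.contDiff.comp hv
  have hpc : HasCompactSupport (fun x => L (v x)) := hvc.comp_left (map_zero L)
  have hpd : ∀ x, HasFDerivAt (fun x => L (v x)) (L.comp (fderiv ℝ v x)) x := fun x =>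
    L.hasFDerivAt.comp x (hv.differentiable (by simp) x).hasFDerivAt
  have hFd : ∀ x, HasFDerivAt (fun x => w x - L (v x)) (fderiv ℝ w x - L.comp (fderiv ℝ v x)) x :=
    fun x => (hw.differentiable (by simp) x).hasFDerivAt.sub (hpd x)
  have hF : ContDiff ℝ (⊤ : ℕ∞) (fun x => w x - L (v x)) := hw.sub hp
  have hFc : HasCompactSupport (fun x => w x - L (v x)) := hwc.sub hpc
  refine ⟨fun x => w x - L (v x), hF, hFc, ?_, ?_, ?_⟩
  · intro x
    have h1 : ‖L (v x)‖ ≤ ‖a‖ * M :=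
      (L.le_opNorm _).trans (by rw [hLn]; exact mul_le_mul_of_nonneg_left (hM x) ha0)
    have h2 : w x - L (v x) - w x = - L (v x) := by ring
    rw [h2, abs_neg, ← Real.norm_eq_abs]
    nlinarith
  · calc ∫ x, ‖fderiv ℝ (fun x => w x - L (v x)) x‖
        ≤ ∫ x, (‖fderiv ℝ w x‖ + ‖a‖ * ‖fderiv ℝ v x‖) := by
          refine integral_mono (int_fd hF hFc) ((int_fd hw hwc).add (hfv.const_mul _)) fun x => ?_
          simp only
          rw [(hFd x).fderiv]
          refine (norm_sub_le _ _).trans ?_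
          rw [← hLn]
          gcongr
          exact ContinuousLinearMap.opNorm_comp_le _ _
      _ = (∫ x, ‖fderiv ℝ w x‖) + ‖a‖ * K := by
          rw [integral_add (int_fd hw hwc) (hfv.const_mul _), integral_const_mul]
      _ ≤ _ := by nlinarith
  · refine hcount.mono fun x hx => ?_
    obtain ⟨hxR, hx0⟩ := hx
    have hvx : fderiv ℝ v x = ContinuousLinearMap.id ℝ 𝔼 := by
      have : v =ᶠ[𝓝 x] id := by
        filter_upwards [isOpen_ball.mem_nhds hxR] with y hy
        have : χ y = 1 := χ.one_of_mem_closedBall (ball_subset_closedBall hy)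
        simp [v, this]
      rw [this.fderiv_eq, fderiv_id]
    rw [(hFd x).fderiv, hvx, sub_eq_zero] at hx0
    simpa using hx0

variable {Ω : Set (EuclideanSpace ℝ (Fin n))}

lemma exists_E (hn : 2 ≤ n) (hm : MeasurableSet Ω) (hb : Bornology.IsBounded Ω)
    (hper : perimeter Ω ≠ ⊤) (hnull : μH[(n:ℝ) - 1] (frontier Ω ∩ densityPts Ω 1) = 0)
    {η : ℝ} (hη : 0 < η) :
    ∃ E : Set 𝔼, IsSmoothSet E ∧ CpctContained E Ω ∧
      volume ((E \ Ω) ∪ (Ω \ E)) ≤ ENNReal.ofReal η ∧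
      perimeter E ≤ ENNReal.ofReal (rP Ω univ + η) := by
  set P := rP Ω univ with hP
  have hP0 : 0 ≤ P := rP_nonneg _ _
  set τ := min (1/4) (η / (4 * (P + η))) with hτ
  have hτ0 : 0 < τ := by positivity
  have hτ1 : τ ≤ 1/4 := min_le_left _ _
  have hτ2 : τ * (4 * (P + η)) ≤ η := by
    rw [← le_div_iff₀ (by positivity)]; exact min_le_right _ _
  set κ := min (η / 4) (η * τ / 2) with hκ
  have hκ0 : 0 < κ := by positivity
  have hκ1 : κ ≤ η / 4 := min_le_left _ _
  have hκ2 : κ ≤ η * τ / 2 := min_le_right _ _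
  obtain ⟨w, hw, hws, hwL, hwP⟩ := exists_w hn hm hb hper hnull hκ0
  obtain ⟨R, hR0, hR⟩ := hb.subset_ball_lt 0 0
  obtain ⟨F, hF, hFc, hFw, hFP, hcount⟩ := exists_perturb hw.cd hw.cs (ε := min κ (τ / 2)) hR0
    (by positivity)
  have hFw2 : ∀ x, |F x - w x| ≤ τ / 2 := fun x => (hFw x).trans (min_le_right _ _)
  have hFP2 : ∫ x, ‖fderiv ℝ F x‖ ≤ P + 2 * κ := by
    have := min_le_left κ (τ / 2); linarith
  obtain ⟨t, ht, htN, htP⟩ := exists_level hF hFc (a := τ) (b := 1 - τ) (by linarith)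
    ((hcount.image F).measure_zero volume)
  have hsub : {x | t ≤ F x} ⊆ tsupport w := by
    intro x hx
    apply subset_tsupport
    have h1 := abs_le.1 (hFw2 x)
    have : 0 < w x := by have := ht.1; simp only [mem_ofPred_eq] at hx; linarith
    exact this.ne'
  have hclosed : IsClosed {x | t ≤ F x} := isClosed_le continuous_const hF.continuous
  have hopen : IsOpen {x | t < F x} := isOpen_lt continuous_const hF.continuous
  have hcl : closure {x | t < F x} ⊆ {x | t ≤ F x} :=
    closure_minimal (fun x (hx : t < F x) => (show t ≤ F x from hx.le)) hclosed
  have hcomp : IsCompact (closure {x | t < F x}) :=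
    IsCompact.of_isClosed_subset hw.cs isClosed_closure (hcl.trans hsub)
  have hclΩ : closure {x | t < F x} ⊆ Ω := (hcl.trans hsub).trans (hws.trans interior_subset)
  have hreg : ∀ x, F x = t → fderiv ℝ F x ≠ 0 := by
    intro x hx h0
    apply htN
    refine ⟨x, ⟨hR (interior_subset (hws (hsub ?_))), h0⟩, hx⟩
    exact hx.ge
  have hfr : frontier {x | t < F x} = {x | F x = t} := by
    apply Subset.antisymm
    · intro x hx
      exact (frontier_lt_subset_eq continuous_const hF.continuous hx).symm
    · intro x hx
      rw [frontier, hopen.interior_eq]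
      refine ⟨?_, fun h => (ne_of_gt h) hx⟩
      by_contra hnot
      have hmax : IsLocalMax F x := by
        filter_upwards [isClosed_closure.isOpen_compl.mem_nhds hnot] with y hy
        have : ¬ t < F y := fun h => hy (subset_closure h)
        rw [show F x = t from hx]
        exact not_lt.1 this
      exact hreg x hx hmax.fderiv_eq_zero
  refine ⟨{x | t < F x}, ⟨hopen, hcomp.isBounded.subset subset_closure, fun x => t - F x,
    contDiff_const.sub hF, ?_, ?_, ?_⟩, ⟨hcomp, hclΩ⟩, ?_, ?_⟩
  · ext x; simp
  · rw [hfr]; ext x; simp only [mem_ofPred_eq]; constructor <;> intro h <;> linarith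
  · intro x hx
    rw [hfr] at hx
    rw [fderiv_const_sub]
    exact neg_ne_zero.2 (hreg x hx)
  · have h1 : ({x | t < F x} \ Ω) ∪ (Ω \ {x | t < F x}) ⊆ {x | τ / 2 ≤ |w x - ind Ω x|} := by
      rintro x (hx | hx)
      · exact absurd (hclΩ (subset_closure hx.1)) hx.2
      · have h2 : F x ≤ t := not_lt.1 hx.2
        have h3 := abs_le.1 (hFw2 x)
        have h4 : ind Ω x = 1 := by simp [ind, hx.1]
        have h5 := ht.2
        simp only [mem_ofPred_eq]
        rw [h4, abs_sub_comm]
        refine le_trans ?_ (le_abs_self _)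
        linarith
    have hintg : Integrable (fun x => |w x - ind Ω x|) := (hw.int.sub (ind_integrable hm hb)).abs
    have h2 := mul_meas_ge_le_integral_of_nonneg (ae_of_all _ fun x => abs_nonneg _) hintg (τ / 2)
    refine (measure_mono h1).trans ?_
    have hfin : volume {x | τ / 2 ≤ |w x - ind Ω x|} ≠ ⊤ :=
      (hintg.measure_ge_lt_top (by positivity)).ne
    rw [← ENNReal.ofReal_toReal hfin]
    refine ENNReal.ofReal_le_ofReal ?_
    have h3 : τ / 2 * (volume {x | τ / 2 ≤ |w x - ind Ω x|}).toReal ≤ τ / 2 * η := by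
      have : τ / 2 * volume.real {x | τ / 2 ≤ |w x - ind Ω x|} ≤ _ := h2
      refine this.trans (hwL.trans (hκ2.trans (by linarith)))
    exact le_of_mul_le_mul_left h3 (by positivity)
  · refine htP.trans (ENNReal.ofReal_le_ofReal ?_)
    rw [div_le_iff₀ (by linarith)]
    nlinarith

end Perturb

/-! ### Lower semicontinuity -/
section Final
variable {n : ℕ}

local notation "𝔼" => EuclideanSpace ℝ (Fin n)

lemma lsc {Ω : Set 𝔼} {E : ℕ → Set 𝔼} (hm : MeasurableSet Ω) (hE : ∀ k, MeasurableSet (E k))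
    (h : TendstoL1 E Ω) {c : ℝ≥0∞} (hc : c < perimeter Ω) : ∀ᶠ k in atTop, c < perimeter (E k) := by
  have : ∃ φ : 𝔼 → 𝔼, IsTest univ φ ∧ c < ENNReal.ofReal (∫ x in Ω, vdiv φ x) := by
    by_contra! hcon
    exact absurd (relP_le hcon) (not_le.2 hc)
  obtain ⟨φ, hφ, hlt⟩ := this
  obtain ⟨M, hM⟩ := (vdiv_continuous hφ.cd).bounded_above_of_compact_support (vdiv_hcs hφ.cs)
  have hintg := vdiv_integrable hφ.cd hφ.cs
  have hsd : ∀ k, MeasurableSet ((E k \ Ω) ∪ (Ω \ E k)) := fun k =>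
    ((hE k).diff hm).union (hm.diff (hE k))
  have hreal : Tendsto (fun k => ∫ x in (E k \ Ω) ∪ (Ω \ E k), ‖vdiv φ x‖) atTop (𝓝 0) :=
    hintg.norm.tendsto_setIntegral_nhds_zero h
  have hlim : Tendsto (fun k => ∫ x in E k, vdiv φ x) atTop (𝓝 (∫ x in Ω, vdiv φ x)) := by
    rw [tendsto_iff_norm_sub_tendsto_zero]
    refine squeeze_zero (fun k => norm_nonneg _) (fun k => ?_) hreal
    rw [← integral_indicator (hE k), ← integral_indicator hm, ← integral_indicator (hsd k),
      ← integral_sub (hintg.indicator (hE k)) (hintg.indicator hm)]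
    refine norm_integral_le_of_norm_le (hintg.norm.indicator (hsd k)) (ae_of_all _ fun x => ?_)
    by_cases h1 : x ∈ E k <;> by_cases h2 : x ∈ Ω <;> simp [h1, h2]
  have hlim2 := (ENNReal.continuous_ofReal.tendsto _).comp hlim
  filter_upwards [hlim2.eventually (lt_mem_nhds hlt)] with k hk
  exact lt_of_lt_of_le hk hφ.le_relP

end Final

/-- If `Ω ⊆ ℝⁿ` (`n ≥ 2`) is a bounded set of finite perimeter with
`H^{n-1}(∂Ω ∩ Ω¹) = 0`, then there are smooth bounded open sets `E k ⋐ Ω` with `E k → Ω` in `L¹`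
and `P(E k) → P(Ω)`. -/
theorem smooth_interior_approx_of_null (n : ℕ) (hn : 2 ≤ n)
    (Ω : Set (EuclideanSpace ℝ (Fin n)))
    (hb : Bornology.IsBounded Ω) (hm : MeasurableSet Ω) (hper : perimeter Ω ≠ ⊤)
    (hnull : μH[(n : ℝ) - 1] (frontier Ω ∩ densityPts Ω 1) = 0) :
    ∃ E : ℕ → Set (EuclideanSpace ℝ (Fin n)),
      (∀ k, IsSmoothSet (E k)) ∧
      (∀ k, CpctContained (E k) Ω) ∧
      TendstoL1 E Ω ∧
      Tendsto (fun k => perimeter (E k)) atTop (𝓝 (perimeter Ω)) := by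
  have hpos : ∀ k : ℕ, (0:ℝ) < 1 / ((k:ℝ) + 1) := fun k => by positivity
  choose E h1 h2 h3 h4 using fun k : ℕ => exists_E hn hm hb hper hnull (hpos k)
  have h0 : Tendsto (fun k : ℕ => 1 / ((k:ℝ) + 1)) atTop (𝓝 0) := tendsto_one_div_add_atTop_nhds_zero_nat
  have hL : TendstoL1 E Ω := by
    have := (ENNReal.continuous_ofReal.tendsto _).comp h0
    rw [ENNReal.ofReal_zero] at this
    exact tendsto_of_tendsto_of_tendsto_of_le_of_le tendsto_const_nhds this
      (fun _ => zero_le) h3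
  refine ⟨E, h1, h2, hL, ?_⟩
  have hup : Tendsto (fun k : ℕ => ENNReal.ofReal (rP Ω univ + 1 / ((k:ℝ) + 1))) atTop
      (𝓝 (perimeter Ω)) := by
    have := (ENNReal.continuous_ofReal.tendsto _).comp (h0.const_add (rP Ω univ))
    rw [add_zero, show ENNReal.ofReal (rP Ω univ) = perimeter Ω from ENNReal.ofReal_toReal hper] at this
    exact this
  rw [tendsto_order]
  refine ⟨fun c hc => lsc hm (fun k => (h1 k).1.measurableSet) hL hc, fun c hc => ?_⟩
  filter_upwards [hup.eventually (gt_mem_nhds hc)] with k hk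
  exact (h4 k).trans_lt hk
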